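/- Let β > 0 with β² ≠ 1/4, set γ = √(1/4 − β²) (principal square root) and μ = Re γ. For each integer m ≥ 1 let ρ⁰_m, ω⁰_m : ℝ → ℂ be smooth and compactly supported, set W(ζ) = W_{0,γ}(2mζ), G_m(η,ξ,y) = (∂_y² − m²)(ρ⁰_m(ξ+y−η) − β^{−2} ξ ω⁰_m(ξ+y−η)), ψ_m(t,y) = (e^{−imyt} cos(γπ)/(2mπ)) [∫₀^∞ e^{imηt} W(η) ∫₀^∞ W(ξ) G_m(η,ξ,y) dξ dη − ∫₀^∞ e^{−imηt} W(η) ∫₀^∞ W(ξ) G_m(−η,−ξ,y) dξ dη], and Q_{2,m} = ∑_{k=0}^{4} (‖∂_y^k ρ⁰_m‖_{L²(ℝ)} + ‖∂_y^k ω⁰_m‖_{L²(ℝ)}). Then there exists a constant C > 0 depending only on β such that for all t ≥ 1, ( ∑_{m=1}^∞ m² ‖ψ_m(t,·)‖²_{L²(ℝ)} )^{1/2} ≤ C t^{−3/2+μ} ( ∑_{m=1}^∞ Q_{2,m}² )^{1/2}. -/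

import Mathlib

open MeasureTheory Complex Set
open scoped ENNReal Real

noncomputable section

/-- Pochhammer symbol `(a)_s = a (a+1) ⋯ (a+s−1)`. -/
def poch (a : ℂ) (s : ℕ) : ℂ := ∏ i ∈ Finset.range s, (a + (i : ℂ))

/-- Confluent hypergeometric function `M(a,b,ζ) = ∑_s (a)_s/((b)_s s!) ζ^s`. -/
def chgM (a b ζ : ℂ) : ℂ := ∑' s : ℕ, poch a s / (poch b s * (Nat.factorial s : ℂ)) * ζ ^ s

/-- Whittaker function `M_{0,γ}(ζ) = e^{−ζ/2} ζ^{1/2+γ} M(1/2+γ, 1+2γ, ζ)`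
(principal branch of the complex power). -/
def whittM (γ ζ : ℂ) : ℂ :=
  Complex.exp (-ζ / 2) * ζ ^ ((1 : ℂ) / 2 + γ) * chgM ((1 : ℂ) / 2 + γ) (1 + 2 * γ) ζ

/-- Whittaker function
`W_{0,γ}(ζ) = (Γ(−2γ)/Γ(1/2−γ)) M_{0,γ}(ζ) + (Γ(2γ)/Γ(1/2+γ)) M_{0,−γ}(ζ)`. -/
def whittW (γ ζ : ℂ) : ℂ :=
  Complex.Gamma (-(2 * γ)) / Complex.Gamma ((1 : ℂ) / 2 - γ) * whittM γ ζ
    + Complex.Gamma (2 * γ) / Complex.Gamma ((1 : ℂ) / 2 + γ) * whittM (-γ) ζ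

/-- `γ = √(1/4 − β²)`, principal square root. -/
def gam (β : ℝ) : ℂ := ((1 / 4 - β ^ 2 : ℝ) : ℂ) ^ ((1 : ℂ) / 2)

/-- `G_m(η,ξ,y) = (∂_y² − m²)(ρ⁰(ξ+y−η) − β^{−2} ξ ω⁰(ξ+y−η))`. -/
def Gm (β : ℝ) (m : ℕ) (ρ₀ ω₀ : ℝ → ℂ) (η ξ y : ℝ) : ℂ :=
  (deriv (deriv ρ₀) (ξ + y - η) - (m : ℂ) ^ 2 * ρ₀ (ξ + y - η))
    - (1 / (β : ℂ) ^ 2) * (ξ : ℂ) *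
        (deriv (deriv ω₀) (ξ + y - η) - (m : ℂ) ^ 2 * ω₀ (ξ + y - η))

/-- The explicit stream-function mode `ψ_m(t,y)` of Theorem 1.1, with
`W(ζ) = W_{0,γ}(2mζ)`. -/
def psiM (β : ℝ) (m : ℕ) (ρ₀ ω₀ : ℝ → ℂ) (t y : ℝ) : ℂ :=
  Complex.exp (-(Complex.I * m * y * t)) * Complex.cos (gam β * (π : ℂ)) / (2 * m * (π : ℂ)) *
    ((∫ η in Set.Ioi (0 : ℝ), Complex.exp (Complex.I * m * η * t) *
        whittW (gam β) (2 * (m : ℂ) * (η : ℂ)) *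
        ∫ ξ in Set.Ioi (0 : ℝ), whittW (gam β) (2 * (m : ℂ) * (ξ : ℂ)) * Gm β m ρ₀ ω₀ η ξ y)
      - ∫ η in Set.Ioi (0 : ℝ), Complex.exp (-(Complex.I * m * η * t)) *
          whittW (gam β) (2 * (m : ℂ) * (η : ℂ)) *
          ∫ ξ in Set.Ioi (0 : ℝ), whittW (gam β) (2 * (m : ℂ) * (ξ : ℂ)) * Gm β m ρ₀ ω₀ (-η) (-ξ) y)

/-- `Q_{j,m}`-type quantity: sum of the `L²` norms of the first `n−1` derivatives of the data. -/
def Qsum (n : ℕ) (ρ₀ ω₀ : ℝ → ℂ) : ℝ≥0∞ :=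
  ∑ k ∈ Finset.range n,
    (eLpNorm (iteratedDeriv k ρ₀) 2 (volume : Measure ℝ)
      + eLpNorm (iteratedDeriv k ω₀) 2 (volume : Measure ℝ))

lemma expCoeff_summable {c : ℕ → ℂ} (hc : ∀ s, ‖c s‖ ≤ 1 / (s.factorial : ℝ)) (z : ℂ) :
    Summable fun s : ℕ => c s * z ^ s := by
  refine Summable.of_norm_bounded (g := fun s : ℕ => ‖z‖ ^ s / (s.factorial : ℝ))
    (Real.summable_pow_div_factorial ‖z‖) fun s => ?_
  rw [norm_mul, norm_pow, div_eq_mul_one_div, mul_comm]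
  gcongr
  exact hc s

lemma expCoeff_shift {c : ℕ → ℂ} (hc : ∀ s, ‖c s‖ ≤ 1 / (s.factorial : ℝ)) (s : ℕ) :
    ‖((s : ℂ) + 1) * c (s + 1)‖ ≤ 1 / (s.factorial : ℝ) := by
  have h := hc (s + 1)
  rw [Nat.factorial_succ] at h
  push_cast at h
  have h1 : ‖(s : ℂ) + 1‖ = (s : ℝ) + 1 := by
    exact_mod_cast Complex.norm_natCast (s + 1)
  rw [norm_mul, h1]
  calc ((s : ℝ) + 1) * ‖c (s + 1)‖
      ≤ ((s : ℝ) + 1) * (1 / (((s : ℝ) + 1) * (s.factorial : ℝ))) := by gcongr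
    _ = 1 / (s.factorial : ℝ) := by field_simp

lemma expCoeff_hasDerivAt {c : ℕ → ℂ} (hc : ∀ s, ‖c s‖ ≤ 1 / (s.factorial : ℝ)) (z : ℂ) :
    HasDerivAt (fun z => ∑' s : ℕ, c s * z ^ s)
      (∑' s : ℕ, ((s : ℂ) + 1) * c (s + 1) * z ^ s) z := by
  set R : ℝ := ‖z‖ + 1
  have hR : 0 ≤ R := by positivity
  have hu : Summable fun n : ℕ => (n : ℝ) * (1 / (n.factorial : ℝ)) * R ^ (n - 1) := by
    rw [← summable_nat_add_iff 1]
    refine (Real.summable_pow_div_factorial R).congr fun s => ?_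
    rw [Nat.factorial_succ]
    rw [Nat.add_sub_cancel]
    push_cast
    field_simp
  have key := hasDerivAt_tsum_of_isPreconnected (𝕜 := ℂ) (t := Metric.ball (0 : ℂ) R)
    (g := fun n z => c n * z ^ n) (g' := fun n z => c n * ((n : ℂ) * z ^ (n - 1)))
    (y₀ := z) (y := z) hu Metric.isOpen_ball
    (convex_ball (0 : ℂ) R).isPreconnected
    (fun n y _ => (hasDerivAt_pow n y).const_mul (c n))
    (fun n y hy => ?_) (by simp [R]) (expCoeff_summable hc z) (by simp [R])
  · refine key.congr_deriv ?_
    have hs : Summable fun n : ℕ => c n * ((n : ℂ) * z ^ (n - 1)) := by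
      rw [← summable_nat_add_iff 1]
      refine (expCoeff_summable (expCoeff_shift hc) z).congr fun s => ?_
      rw [Nat.add_sub_cancel]
      push_cast
      ring
    rw [hs.tsum_eq_zero_add]
    simp only [Nat.cast_zero, zero_mul, mul_zero, zero_add, Nat.add_sub_cancel]
    refine tsum_congr fun s => ?_
    push_cast
    ring
  · have hy' : ‖y‖ ≤ R := by simpa using (Metric.mem_ball.1 hy).le
    rw [norm_mul, norm_mul, norm_pow, Complex.norm_natCast, ← mul_assoc, mul_comm ‖c n‖]
    gcongr
    exact hc n

lemma norm_two_mul_add_natCast {a : ℂ} (ha : 0 < a.re) (i : ℕ) :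
    ‖a + i‖ ≤ ‖2 * a + i‖ ∧ 2 * a + i ≠ 0 := by
  constructor
  · rw [← sq_le_sq₀ (norm_nonneg _) (norm_nonneg _), ← Complex.normSq_eq_norm_sq,
      ← Complex.normSq_eq_norm_sq, Complex.normSq_apply, Complex.normSq_apply]
    simp
    have : (0 : ℝ) ≤ i := Nat.cast_nonneg i
    nlinarith [mul_nonneg this ha.le, sq_nonneg a.re, sq_nonneg a.im]
  · intro h
    have := congrArg Complex.re h
    simp at this
    have : (0 : ℝ) ≤ i := Nat.cast_nonneg i
    linarith

lemma poch_succ (a : ℂ) (s : ℕ) : poch a (s + 1) = poch a s * (a + s) :=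
  Finset.prod_range_succ _ _

lemma poch_two_mul_ne_zero {a : ℂ} (ha : 0 < a.re) (s : ℕ) : poch (2 * a) s ≠ 0 :=
  Finset.prod_ne_zero_iff.2 fun i _ => (norm_two_mul_add_natCast ha i).2

/-- Taylor coefficients of `M(a, 2a, ·)`. -/
def kummerCoeff (a : ℂ) (s : ℕ) : ℂ := poch a s / (poch (2 * a) s * (Nat.factorial s : ℂ))

lemma kummerCoeff_norm_le {a : ℂ} (ha : 0 < a.re) (s : ℕ) :
    ‖kummerCoeff a s‖ ≤ 1 / (s.factorial : ℝ) := by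
  have h : ‖poch a s‖ ≤ ‖poch (2 * a) s‖ := by
    simp only [poch, norm_prod]
    exact Finset.prod_le_prod (fun _ _ => norm_nonneg _)
      fun i _ => (norm_two_mul_add_natCast ha i).1
  have h0 : 0 < ‖poch (2 * a) s‖ := norm_pos_iff.2 (poch_two_mul_ne_zero ha s)
  rw [kummerCoeff, norm_div, norm_mul, Complex.norm_natCast, div_le_div_iff₀ (by positivity)
    (by positivity)]
  nlinarith [Nat.cast_pos (α := ℝ).2 s.factorial_pos]

lemma kummerCoeff_succ {a : ℂ} (ha : 0 < a.re) (s : ℕ) :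
    ((s : ℂ) + 1) * (2 * a + s) * kummerCoeff a (s + 1) = (a + s) * kummerCoeff a s := by
  have h1 := poch_two_mul_ne_zero ha s
  have h2 := (norm_two_mul_add_natCast ha s).2
  have h3 : (s.factorial : ℂ) ≠ 0 := by exact_mod_cast s.factorial_ne_zero
  have h4 : (s : ℂ) + 1 ≠ 0 := by exact_mod_cast s.succ_ne_zero
  rw [kummerCoeff, kummerCoeff, poch_succ, poch_succ, Nat.factorial_succ]
  push_cast
  field_simp

lemma expCoeff_hasSum_natCast_mul {c : ℕ → ℂ} (hc : ∀ s, ‖c s‖ ≤ 1 / (s.factorial : ℝ)) (z : ℂ) :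
    HasSum (fun s : ℕ => (s : ℂ) * c s * z ^ s)
      (z * ∑' s : ℕ, ((s : ℂ) + 1) * c (s + 1) * z ^ s) := by
  rw [← hasSum_nat_add_iff' 1]
  simp only [Finset.range_one, Finset.sum_singleton, Nat.cast_zero, zero_mul, sub_zero]
  refine ((expCoeff_summable (expCoeff_shift hc) z).hasSum.mul_left z).congr_fun fun s => ?_
  push_cast
  ring

lemma exists_chgM_deriv {a : ℂ} (ha : 0 < a.re) :
    ∃ F₁ F₂ : ℂ → ℂ, (∀ z, HasDerivAt (chgM a (2 * a)) (F₁ z) z) ∧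
      (∀ z, HasDerivAt F₁ (F₂ z) z) ∧ Continuous F₂ ∧
      ∀ z, z * F₂ z + (2 * a - z) * F₁ z - a * chgM a (2 * a) z = 0 := by
  have hc := kummerCoeff_norm_le ha
  have hc1 := expCoeff_shift hc
  have hc2 := expCoeff_shift hc1
  refine ⟨_, _, fun z => expCoeff_hasDerivAt hc z, fun z => expCoeff_hasDerivAt hc1 z,
    continuous_iff_continuousAt.2 fun z => (expCoeff_hasDerivAt hc2 z).continuousAt, fun z => ?_⟩
  have e2 := expCoeff_hasSum_natCast_mul hc1 z
  have e1 := (expCoeff_summable hc1 z).hasSum.mul_left (2 * a)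
  have e1' := expCoeff_hasSum_natCast_mul hc z
  have e0 := (expCoeff_summable hc z).hasSum.mul_left a
  have h := ((e2.add e1).sub e1').sub e0
  have h0 : HasSum (fun _ : ℕ => (0 : ℂ)) 0 := hasSum_zero
  refine Eq.trans ?_ (h.unique (h0.congr_fun fun s => ?_))
  · simp only [chgM, kummerCoeff]
    ring
  · linear_combination z ^ s * kummerCoeff_succ ha s

lemma Gamma_add_natCast {a : ℂ} (ha : 0 < a.re) (s : ℕ) :
    Complex.Gamma (a + s) = poch a s * Complex.Gamma a := by
  induction s with
  | zero => simp [poch]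
  | succ s ih =>
    have h : a + s ≠ 0 := by
      intro h
      have := congrArg Complex.re h
      simp at this
      have : (0 : ℝ) ≤ s := Nat.cast_nonneg s
      linarith
    rw [poch_succ, Nat.cast_succ, ← add_assoc, Complex.Gamma_add_one _ h, ih]
    ring

lemma betaIntegral_add_natCast {a : ℂ} (ha : 0 < a.re) (s : ℕ) :
    Complex.betaIntegral (a + s) a
      = kummerCoeff a s * (s.factorial : ℂ) * (Complex.Gamma a ^ 2 / Complex.Gamma (2 * a)) := by
  have h2a : 0 < (2 * a).re := by simpa using ha
  have h1 : 0 < (a + s).re := by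
    simp only [Complex.add_re, Complex.natCast_re]; positivity
  have h := Complex.Gamma_mul_Gamma_eq_betaIntegral h1 ha
  rw [show a + s + a = 2 * a + s by ring, Gamma_add_natCast ha, Gamma_add_natCast h2a] at h
  have g1 := Complex.Gamma_ne_zero_of_re_pos h2a
  have g2 := poch_two_mul_ne_zero ha s
  have h3 : (s.factorial : ℂ) ≠ 0 := by exact_mod_cast s.factorial_ne_zero
  rw [kummerCoeff]
  generalize poch (2 * a) s = p at *
  generalize Complex.Gamma (2 * a) = g at *
  field_simp
  linear_combination -h

lemma chgM_eq_integral {a : ℂ} (ha : 0 < a.re) (z : ℂ) :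
    chgM a (2 * a) z * (Complex.Gamma a ^ 2 / Complex.Gamma (2 * a)) =
      ∫ t in (0 : ℝ)..1, Complex.exp (z * t) * ((t : ℂ) ^ (a - 1) * (1 - (t : ℂ)) ^ (a - 1)) := by
  have hI := Complex.betaIntegral_convergent ha ha
  set b : ℝ → ℂ := fun t => (t : ℂ) ^ (a - 1) * (1 - (t : ℂ)) ^ (a - 1) with hb
  have hbm : AEStronglyMeasurable b (volume.restrict (Set.uIoc 0 1)) :=
    (intervalIntegrable_iff.1 hI).aestronglyMeasurable
  have key := intervalIntegral.hasSum_integral_of_dominated_convergence (μ := volume)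
    (a := 0) (b := 1)
    (F := fun (s : ℕ) (t : ℝ) => z ^ s / (s.factorial : ℂ) * (t : ℂ) ^ s * b t)
    (f := fun t => Complex.exp (z * t) * b t)
    (fun s t => ‖z‖ ^ s / (s.factorial : ℝ) * ‖b t‖)
    (fun s => ?_) (fun s => ?_) ?_ ?_ ?_
  · have h1 : ∀ s : ℕ, (∫ t in (0 : ℝ)..1, z ^ s / (s.factorial : ℂ) * (t : ℂ) ^ s * b t)
        = kummerCoeff a s * z ^ s * (Complex.Gamma a ^ 2 / Complex.Gamma (2 * a)) := by
      intro s
      have h3 : (s.factorial : ℂ) ≠ 0 := by exact_mod_cast s.factorial_ne_zero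
      have h4 : (∫ t in (0 : ℝ)..1, (t : ℂ) ^ s * b t) = Complex.betaIntegral (a + s) a := by
        rw [Complex.betaIntegral]
        refine intervalIntegral.integral_congr_ae (Filter.Eventually.of_forall fun t ht => ?_)
        rw [Set.uIoc_of_le zero_le_one] at ht
        have ht0 : (t : ℂ) ≠ 0 := by exact_mod_cast ht.1.ne'
        simp only [hb]
        rw [show a + (s : ℂ) - 1 = (a - 1) + (s : ℂ) by ring, Complex.cpow_add _ _ ht0,
          Complex.cpow_natCast]
        ring
      simp only [mul_assoc]
      rw [intervalIntegral.integral_const_mul, h4, betaIntegral_add_natCast ha]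
      field_simp
    simp only [h1] at key
    exact ((expCoeff_summable (kummerCoeff_norm_le ha) z).hasSum.mul_right _).unique key
  · exact (by fun_prop : Continuous fun t : ℝ => z ^ s / (s.factorial : ℂ) * (t : ℂ) ^ s)
      |>.aestronglyMeasurable.mul hbm
  · refine Filter.Eventually.of_forall fun t ht => ?_
    rw [Set.uIoc_of_le zero_le_one] at ht
    rw [norm_mul, norm_mul, norm_div, norm_pow, norm_pow, Complex.norm_natCast, Complex.norm_real]
    have : ‖t‖ ^ s ≤ 1 := pow_le_one₀ (norm_nonneg _) (by
      rw [Real.norm_eq_abs, abs_of_pos ht.1]; exact ht.2)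
    have h0 : 0 ≤ ‖z‖ ^ s / (s.factorial : ℝ) := by positivity
    gcongr
    nlinarith
  · exact Filter.Eventually.of_forall fun t _ =>
      (Real.summable_pow_div_factorial ‖z‖).mul_right _
  · simp only [tsum_mul_right]
    exact hI.norm.const_mul _
  · refine Filter.Eventually.of_forall fun t _ => HasSum.mul_right _ ?_
    have h := NormedSpace.expSeries_div_hasSum_exp (z * (t : ℂ))
    rw [← Complex.exp_eq_exp_ℂ] at h
    refine h.congr_fun fun s => ?_
    rw [mul_pow]
    ring

/-- Watson's lemma for the symmetric beta density. -/
lemma tendsto_laplace_beta {a : ℂ} (ha : 0 < a.re) (ha1 : a.re < 1) :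
    Filter.Tendsto (fun x : ℝ => (x : ℂ) ^ a *
      ∫ t in (0 : ℝ)..1, Complex.exp (-(x * t)) * ((t : ℂ) ^ (a - 1) * (1 - (t : ℂ)) ^ (a - 1)))
      Filter.atTop (nhds (Complex.Gamma a)) := by
  have hI := Complex.betaIntegral_convergent ha ha
  set b : ℝ → ℂ := fun t => (t : ℂ) ^ (a - 1) * (1 - (t : ℂ)) ^ (a - 1) with hb
  have hIx : ∀ x : ℝ, IntervalIntegrable (fun t : ℝ => Complex.exp (-(x * t)) * b t) volume 0 1 :=
    fun x => hI.continuousOn_mul (by fun_prop)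
  have hsplit : ∀ x : ℝ, (∫ t in (0 : ℝ)..1, Complex.exp (-(x * t)) * b t)
      = (∫ t in (0 : ℝ)..(1/2), Complex.exp (-(x * t)) * b t)
        + ∫ t in (1/2 : ℝ)..1, Complex.exp (-(x * t)) * b t := fun x =>
    (intervalIntegral.integral_add_adjacent_intervals
      ((hIx x).mono_set (by
        rw [Set.uIcc_of_le (by norm_num), Set.uIcc_of_le (by norm_num)]
        exact Set.Icc_subset_Icc le_rfl (by norm_num)))
      ((hIx x).mono_set (by
        rw [Set.uIcc_of_le (by norm_num), Set.uIcc_of_le (by norm_num)]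
        exact Set.Icc_subset_Icc (by norm_num) le_rfl))).symm
  have hIr : IntervalIntegrable b volume (1/2) 1 := hI.mono_set (by
        rw [Set.uIcc_of_le (by norm_num), Set.uIcc_of_le (by norm_num)]
        exact Set.Icc_subset_Icc (by norm_num) le_rfl)
  change Filter.Tendsto (fun x : ℝ => (x : ℂ) ^ a *
      ∫ t in (0 : ℝ)..1, Complex.exp (-(x * t)) * b t) _ _
  simp only [hsplit, mul_add]
  rw [← add_zero (Complex.Gamma a)]
  refine Filter.Tendsto.add ?_ ?_
  · -- rescale to the half line and use dominated convergence
    rw [Complex.Gamma_eq_integral ha, Complex.GammaIntegral]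
    have hrw : ∀ᶠ x : ℝ in Filter.atTop, (∫ u in Set.Ioi (0 : ℝ),
        (Set.Ioc 0 (x / 2)).indicator (fun u : ℝ => (Real.exp (-u) : ℂ) * ((u : ℂ) ^ (a - 1) *
          (1 - ((u / x : ℝ) : ℂ)) ^ (a - 1))) u)
        = (x : ℂ) ^ a * ∫ t in (0 : ℝ)..(1/2), Complex.exp (-(x * t)) * b t := by
      filter_upwards [Filter.eventually_gt_atTop 0] with x hx
      have hx0 : (x : ℂ) ≠ 0 := by exact_mod_cast hx.ne'
      have hsub := intervalIntegral.integral_comp_mul_left (a := 0) (b := 1/2)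
        (fun u : ℝ => (Real.exp (-u) : ℂ) * ((u : ℂ) ^ (a - 1) *
          (1 - ((u / x : ℝ) : ℂ)) ^ (a - 1))) hx.ne'
      rw [setIntegral_indicator measurableSet_Ioc,
        Set.inter_eq_right.2 Set.Ioc_subset_Ioi_self,
        ← intervalIntegral.integral_of_le (by positivity)]
      rw [mul_zero, mul_one_div] at hsub
      rw [← intervalIntegral.integral_const_mul]
      have : (∫ u in (0:ℝ)..x / 2, (Real.exp (-u) : ℂ) * ((u : ℂ) ^ (a - 1) *
          (1 - ((u / x : ℝ) : ℂ)) ^ (a - 1))) = (x : ℂ) * ∫ t in (0:ℝ)..1/2,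
          (Real.exp (-(x * t)) : ℂ) * (((x * t : ℝ) : ℂ) ^ (a - 1) *
          (1 - ((x * t / x : ℝ) : ℂ)) ^ (a - 1)) := by
        rw [hsub, Complex.real_smul]
        push_cast
        field_simp
      rw [this, ← intervalIntegral.integral_const_mul]
      refine intervalIntegral.integral_congr_ae (Filter.Eventually.of_forall fun t ht => ?_)
      rw [Set.uIoc_of_le (by norm_num)] at ht
      simp only [hb]
      rw [mul_div_cancel_left₀ _ hx.ne', Complex.ofReal_mul,
        Complex.mul_cpow_ofReal_nonneg hx.le ht.1.le, Complex.cpow_sub _ _ hx0, Complex.cpow_one]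
      push_cast
      field_simp
    refine Filter.Tendsto.congr' hrw ?_
    refine MeasureTheory.tendsto_integral_filter_of_dominated_convergence
      (fun u => Real.exp (-u) * u ^ (a.re - 1) * (1/2 : ℝ) ^ (a.re - 1)) ?_ ?_ ?_ ?_
    · refine Filter.Eventually.of_forall fun x => ?_
      exact (Measurable.indicator (by fun_prop) measurableSet_Ioc).aestronglyMeasurable
    · filter_upwards [Filter.eventually_gt_atTop 0] with x hx
      rw [ae_restrict_iff' measurableSet_Ioi]
      refine Filter.Eventually.of_forall fun u hu => ?_
      have hu : 0 < u := hu
      by_cases h : u ∈ Set.Ioc 0 (x / 2)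
      · rw [Set.indicator_of_mem h]
        have h1 : u / x ≤ 1 / 2 := by rw [div_le_iff₀ hx]; linarith [h.2]
        rw [norm_mul, norm_mul, Complex.norm_real, Real.norm_eq_abs, Real.abs_exp,
          Complex.norm_cpow_eq_rpow_re_of_pos hu, ← Complex.ofReal_one, ← Complex.ofReal_sub,
          Complex.norm_cpow_eq_rpow_re_of_pos (by linarith), mul_assoc]
        simp only [Complex.sub_re, Complex.ofReal_re]
        have := Real.rpow_le_rpow_of_nonpos (z := a.re - 1) (x := 1/2) (y := 1 - u / x)
          (by norm_num) (by linarith) (by linarith)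
        gcongr
      · rw [Set.indicator_of_notMem h]
        simp only [norm_zero]
        positivity
    · have := (Real.GammaIntegral_convergent ha).mul_const ((1/2 : ℝ) ^ (a.re - 1))
      exact this
    · rw [ae_restrict_iff' measurableSet_Ioi]
      refine Filter.Eventually.of_forall fun u hu => ?_
      have hu : 0 < u := hu
      have hev : ∀ᶠ x : ℝ in Filter.atTop, (Real.exp (-u) : ℂ) * ((u : ℂ) ^ (a - 1) *
          (1 - ((u / x : ℝ) : ℂ)) ^ (a - 1)) = (Set.Ioc 0 (x / 2)).indicator (fun u : ℝ =>
          (Real.exp (-u) : ℂ) * ((u : ℂ) ^ (a - 1) * (1 - ((u / x : ℝ) : ℂ)) ^ (a - 1))) u := by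
        filter_upwards [Filter.eventually_ge_atTop (2 * u)] with x hx
        have hmem : u ∈ Set.Ioc 0 (x / 2) := ⟨hu, by linarith⟩
        rw [Set.indicator_of_mem hmem]
      refine Filter.Tendsto.congr' hev ?_
      have h1 : Filter.Tendsto (fun x : ℝ => (1 - ((u / x : ℝ) : ℂ))) Filter.atTop (nhds 1) := by
        have h2 : Filter.Tendsto (fun x : ℝ => u / x) Filter.atTop (nhds 0) :=
          Filter.Tendsto.const_div_atTop Filter.tendsto_id u
        have := (Complex.continuous_ofReal.tendsto 0).comp h2
        simpa using this.const_sub (1 : ℂ)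
      have h2 : Filter.Tendsto (fun x : ℝ => (1 - ((u / x : ℝ) : ℂ)) ^ (a - 1)) Filter.atTop
          (nhds (1 ^ (a - 1))) :=
        (continuousAt_cpow_const (a := 1) (b := a - 1) (by simp)).tendsto.comp h1
      rw [Complex.one_cpow] at h2
      simpa using (h2.const_mul ((u : ℂ) ^ (a - 1))).const_mul (Real.exp (-u) : ℂ)
  · have hbd : ∀ᶠ x : ℝ in Filter.atTop,
        ‖(x : ℂ) ^ a * ∫ t in (1/2 : ℝ)..1, Complex.exp (-(x * t)) * b t‖
          ≤ x ^ a.re * Real.exp (-(1/2) * x) * ∫ t in (1/2 : ℝ)..1, ‖b t‖ := by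
      filter_upwards [Filter.eventually_gt_atTop 0] with x hx
      rw [norm_mul, Complex.norm_cpow_eq_rpow_re_of_pos hx, mul_assoc,
        ← intervalIntegral.integral_const_mul]
      gcongr
      refine intervalIntegral.norm_integral_le_of_norm_le (by norm_num)
        (Filter.Eventually.of_forall fun t ht => ?_) (hIr.norm.const_mul _)
      rw [norm_mul, Complex.norm_exp]
      have : (-((x : ℂ) * t)).re = -(x * t) := by simp
      rw [this]
      gcongr
      nlinarith [ht.1]
    refine squeeze_zero_norm' hbd ?_
    have := tendsto_rpow_mul_exp_neg_mul_atTop_nhds_zero a.re (1/2) (by norm_num)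
    simpa using this.mul_const (∫ t in (1/2 : ℝ)..1, ‖b t‖)

/-- The Whittaker function `M_{0,a-1/2}(2x)` on the half line, up to the factor `2 ^ a`. -/
def whittY (a : ℂ) (x : ℝ) : ℂ := (x : ℂ) ^ a * (Complex.exp (-x) * chgM a (2 * a) (2 * x))

lemma whittM_two_mul (γ : ℂ) {x : ℝ} (hx : 0 < x) :
    whittM γ (2 * (x : ℂ)) = 2 ^ ((1 : ℂ) / 2 + γ) * whittY (1 / 2 + γ) x := by
  have h : (2 * (x : ℂ)) ^ ((1 : ℂ) / 2 + γ) = 2 ^ ((1 : ℂ) / 2 + γ) * (x : ℂ) ^ ((1 : ℂ) / 2 + γ) := by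
    have := Complex.mul_cpow_ofReal_nonneg (a := 2) (b := x) (by norm_num) hx.le (1 / 2 + γ)
    simpa using this
  rw [whittM, whittY, h, show 2 * ((1 : ℂ) / 2 + γ) = 1 + 2 * γ by ring,
    show -(2 * (x : ℂ)) / 2 = -x by ring]
  ring

lemma tendsto_whittY {a : ℂ} (ha : 0 < a.re) (ha1 : a.re < 1) :
    Filter.Tendsto (fun x : ℝ => Complex.exp (-x) * (2 ^ a * whittY a x)) Filter.atTop
      (nhds (Complex.Gamma (2 * a) / Complex.Gamma a)) := by
  have hg := Complex.Gamma_ne_zero_of_re_pos ha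
  have hg2 := Complex.Gamma_ne_zero_of_re_pos (s := 2 * a) (by simpa using ha)
  have h := ((tendsto_laplace_beta ha ha1).comp
    (Filter.Tendsto.const_mul_atTop (zero_lt_two' ℝ) Filter.tendsto_id)).mul_const
      (Complex.Gamma (2 * a) / Complex.Gamma a ^ 2)
  have hlim : Complex.Gamma a * (Complex.Gamma (2 * a) / Complex.Gamma a ^ 2)
      = Complex.Gamma (2 * a) / Complex.Gamma a := by field_simp
  rw [hlim] at h
  refine Filter.Tendsto.congr' ?_ h
  filter_upwards [Filter.eventually_gt_atTop 0] with x hx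
  have hM := chgM_eq_integral ha (2 * x)
  have hrefl := intervalIntegral.integral_comp_sub_left (a := 0) (b := 1)
    (fun t : ℝ => Complex.exp (2 * x * t) * ((t : ℂ) ^ (a - 1) * (1 - (t : ℂ)) ^ (a - 1))) 1
  rw [sub_self, sub_zero] at hrefl
  have hrefl' : (∫ t in (0 : ℝ)..1, Complex.exp (2 * x * t) *
      ((t : ℂ) ^ (a - 1) * (1 - (t : ℂ)) ^ (a - 1))) = Complex.exp (2 * x) *
      ∫ t in (0 : ℝ)..1, Complex.exp (-((2 * x : ℝ) * t)) *
        ((t : ℂ) ^ (a - 1) * (1 - (t : ℂ)) ^ (a - 1)) := by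
    rw [← hrefl, ← intervalIntegral.integral_const_mul]
    refine intervalIntegral.integral_congr fun t _ => ?_
    have h1 : Complex.exp (2 * x * ((1 - t : ℝ) : ℂ))
        = Complex.exp (2 * x) * Complex.exp (-((2 * x : ℝ) * t)) := by
      rw [← Complex.exp_add]
      push_cast
      ring_nf
    rw [h1]
    push_cast
    rw [sub_sub_cancel]
    ring
  rw [hrefl'] at hM
  have hM' : chgM a (2 * a) (2 * x) = (Complex.exp (2 * x) *
      ∫ t in (0 : ℝ)..1, Complex.exp (-((2 * x : ℝ) * t)) *
        ((t : ℂ) ^ (a - 1) * (1 - (t : ℂ)) ^ (a - 1))) *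
        (Complex.Gamma (2 * a) / Complex.Gamma a ^ 2) := by
    rw [← hM]; field_simp
  have hp : ((2 * x : ℝ) : ℂ) ^ a = 2 ^ a * (x : ℂ) ^ a := by
    have := Complex.mul_cpow_ofReal_nonneg (a := 2) (b := x) (by norm_num) hx.le a
    simpa using this
  simp only [Function.comp, id]
  rw [whittY, hM', hp]
  have he : Complex.exp (2 * x) = Complex.exp x * Complex.exp x := by
    rw [← Complex.exp_add]; ring_nf
  rw [he, Complex.exp_neg]
  have := Complex.exp_ne_zero x
  field_simp

lemma exists_whittY_deriv {a : ℂ} (ha : 0 < a.re) :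
    ∃ y₁ : ℝ → ℂ, (∀ x : ℝ, 0 < x → HasDerivAt (whittY a) (y₁ x) x) ∧
      (∀ x : ℝ, 0 < x → HasDerivAt y₁ ((1 + a * (a - 1) / (x : ℂ) ^ 2) * whittY a x) x) ∧
      ∀ X : ℝ, ∃ A : ℝ, 0 < A ∧ ∀ x, 0 < x → x ≤ X →
        ‖whittY a x‖ ≤ A * x ^ a.re ∧ ‖y₁ x‖ ≤ A * x ^ (a.re - 1) := by
  obtain ⟨F₁, F₂, hF, hF1, -, hode⟩ := exists_chgM_deriv ha
  set F := chgM a (2 * a) with hFdef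
  have ha0 : a ≠ 0 := by rintro rfl; simp at ha
  have hlin : ∀ x : ℝ, HasDerivAt (fun x : ℝ => 2 * (x : ℂ)) 2 x := fun x => by
    simpa using (Complex.ofRealCLM.hasDerivAt (x := x)).const_mul (2 : ℂ)
  have hE : ∀ x : ℝ, HasDerivAt (fun x : ℝ => Complex.exp (-(x : ℂ))) (-Complex.exp (-(x : ℂ))) x :=
    fun x => by
      have := (Complex.ofRealCLM.hasDerivAt (x := x)).neg.cexp
      simpa using this
  set u : ℝ → ℂ := fun x => Complex.exp (-x) * F (2 * x) with hu
  set u₁ : ℝ → ℂ := fun x => Complex.exp (-x) * (2 * F₁ (2 * x) - F (2 * x)) with hu1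
  have dF : ∀ x : ℝ, HasDerivAt (fun x : ℝ => F (2 * x)) (F₁ (2 * x) * 2) x := fun x =>
    HasDerivAt.comp (h₂ := F) x (hF (2 * x)) (hlin x)
  have dF1 : ∀ x : ℝ, HasDerivAt (fun x : ℝ => F₁ (2 * x)) (F₂ (2 * x) * 2) x := fun x =>
    HasDerivAt.comp (h₂ := F₁) x (hF1 (2 * x)) (hlin x)
  have du : ∀ x : ℝ, HasDerivAt u (u₁ x) x := fun x =>
    ((hE x).mul (dF x)).congr_deriv (by simp only [hu1]; ring)
  have du1 : ∀ x : ℝ, HasDerivAt u₁ (Complex.exp (-x) *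
      (4 * F₂ (2 * x) - 4 * F₁ (2 * x) + F (2 * x))) x := fun x =>
    ((hE x).mul (((dF1 x).const_mul 2).sub (dF x))).congr_deriv
      (by simp only [Pi.sub_apply]; ring)
  have dp : ∀ x : ℝ, 0 < x → HasDerivAt (fun x : ℝ => (x : ℂ) ^ a) (a * (x : ℂ) ^ (a - 1)) x :=
    fun x hx => hasDerivAt_ofReal_cpow_const hx.ne' ha0
  have hpow : ∀ x : ℝ, 0 < x → (x : ℂ) ^ (a - 1) = (x : ℂ) ^ a / x := fun x hx => by
    rw [Complex.cpow_sub _ _ (by exact_mod_cast hx.ne'), Complex.cpow_one]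
  have hY : whittY a = fun x : ℝ => (x : ℂ) ^ a * u x := rfl
  refine ⟨fun x => (x : ℂ) ^ a * (a / x * u x + u₁ x), fun x hx => ?_, fun x hx => ?_, fun X => ?_⟩
  · rw [hY]
    refine ((dp x hx).mul (du x)).congr_deriv ?_
    rw [hpow x hx]
    ring
  · have hx0 : (x : ℂ) ≠ 0 := by exact_mod_cast hx.ne'
    have dinv : HasDerivAt (fun x : ℝ => a / (x : ℂ)) (-a / (x : ℂ) ^ 2) x := by
      have h := ((Complex.ofRealCLM.hasDerivAt (x := x)).inv (by simpa using hx0)).const_mul a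
      simp only [Complex.ofRealCLM_apply, Complex.ofReal_one] at h
      refine (h.congr_deriv (by ring)).congr_of_eventuallyEq
        (Filter.Eventually.of_forall fun z => ?_)
      simp [div_eq_mul_inv]
    refine ((dp x hx).mul ((dinv.mul (du x)).add (du1 x))).congr_deriv ?_
    rw [hpow x hx, hY]
    have hode' := hode (2 * x)
    simp only [hu, hu1, Pi.mul_apply, Pi.add_apply]
    generalize F (2 * x) = f at *
    generalize F₁ (2 * x) = f1 at *
    generalize F₂ (2 * x) = f2 at *
    field_simp
    linear_combination (2 * (x : ℂ) * (x : ℂ) ^ a) * hode'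
  · have hcu : Continuous u := continuous_iff_continuousAt.2 fun x => (du x).continuousAt
    have hcu1 : Continuous u₁ := continuous_iff_continuousAt.2 fun x => (du1 x).continuousAt
    obtain ⟨B, hB⟩ := (isCompact_Icc (a := (0 : ℝ)) (b := X)).exists_bound_of_continuousOn
      hcu.continuousOn
    obtain ⟨B1, hB1⟩ := (isCompact_Icc (a := (0 : ℝ)) (b := X)).exists_bound_of_continuousOn
      hcu1.continuousOn
    refine ⟨(1 + ‖a‖) * |B| + |X| * |B1| + 1, by positivity, fun x hx hxX => ⟨?_, ?_⟩⟩
    · rw [hY, norm_mul, Complex.norm_cpow_eq_rpow_re_of_pos hx, mul_comm]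
      gcongr
      have h1 := (hB x ⟨hx.le, hxX⟩).trans (le_abs_self B)
      have : 0 ≤ ‖a‖ * |B| := by positivity
      have : 0 ≤ |X| * |B1| := by positivity
      nlinarith
    · have h1 := (hB x ⟨hx.le, hxX⟩).trans (le_abs_self B)
      have h2 := (hB1 x ⟨hx.le, hxX⟩).trans (le_abs_self B1)
      have hx0 : (x : ℂ) ≠ 0 := by exact_mod_cast hx.ne'
      have e : (x : ℂ) ^ a * (a / x * u x + u₁ x) = (x : ℂ) ^ (a - 1) * (a * u x + x * u₁ x) := by
        rw [hpow x hx]; field_simp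
      beta_reduce
      rw [e, norm_mul, Complex.norm_cpow_eq_rpow_re_of_pos hx, mul_comm, Complex.sub_re,
        Complex.one_re]
      gcongr
      have h3 : x ≤ |X| := hxX.trans (le_abs_self X)
      calc ‖a * u x + x * u₁ x‖ ≤ ‖a‖ * ‖u x‖ + x * ‖u₁ x‖ := by
            refine (norm_add_le _ _).trans ?_
            rw [norm_mul a, norm_mul (x : ℂ), Complex.norm_real, Real.norm_eq_abs, abs_of_pos hx]
        _ ≤ ‖a‖ * |B| + |X| * |B1| := by gcongr
        _ ≤ _ := by nlinarith [abs_nonneg B]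

lemma norm_le_exp_neg_of_recessive {y w y₁ w₁ q : ℝ → ℂ} {L : ℂ} {Q : ℝ} (hL : L ≠ 0)
    (hy : ∀ x, 0 < x → HasDerivAt y (y₁ x) x) (hy₁ : ∀ x, 0 < x → HasDerivAt y₁ (q x * y x) x)
    (hw : ∀ x, 0 < x → HasDerivAt w (w₁ x) x) (hw₁ : ∀ x, 0 < x → HasDerivAt w₁ (q x * w x) x)
    (hq : ∀ x, 1 ≤ x → ‖q x‖ ≤ Q)
    (hyL : Filter.Tendsto (fun x : ℝ => Complex.exp (-x) * y x) Filter.atTop (nhds L))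
    (hw0 : Filter.Tendsto (fun x : ℝ => Complex.exp (-x) * w x) Filter.atTop (nhds 0)) :
    ∃ X A : ℝ, 1 ≤ X ∧ 0 < A ∧ ∀ x, X ≤ x →
      ‖w x‖ ≤ A * Real.exp (-x) ∧ ‖w₁ x‖ ≤ A * Real.exp (-x) := by
  have hLpos : 0 < ‖L‖ := norm_pos_iff.2 hL
  have hexp : ∀ x : ℝ, ‖Complex.exp (-(x : ℂ))‖ = Real.exp (-x) := fun x => by
    rw [Complex.norm_exp]; simp
  obtain ⟨X₀, hX₀⟩ := Filter.eventually_atTop.1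
    ((Metric.tendsto_nhds.1 hyL) (‖L‖ / 2) (by positivity))
  set X := max X₀ 1 with hX
  have hX1 : 1 ≤ X := le_max_right _ _
  have hyb : ∀ x, X ≤ x → ‖L‖ / 2 * Real.exp x ≤ ‖y x‖ ∧ ‖y x‖ ≤ 2 * ‖L‖ * Real.exp x := by
    intro x hx
    have h := hX₀ x ((le_max_left _ _).trans hx)
    rw [dist_eq_norm] at h
    have h1 := norm_sub_norm_le L (Complex.exp (-x) * y x)
    have h2 := norm_sub_norm_le (Complex.exp (-x) * y x) L
    rw [norm_sub_rev] at h1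
    rw [norm_mul, hexp] at h1 h2
    have e : ‖y x‖ = Real.exp (-x) * ‖y x‖ * Real.exp x := by
      rw [mul_right_comm, ← Real.exp_add]; simp
    rw [e]
    constructor <;> exact mul_le_mul_of_nonneg_right (by linarith) (Real.exp_pos x).le
  have hyne : ∀ x, X ≤ x → y x ≠ 0 := fun x hx h => by
    have := (hyb x hx).1
    rw [h, norm_zero] at this
    have := Real.exp_pos x
    nlinarith
  set k : ℂ := w₁ X * y X - w X * y₁ X with hk
  have hwr : ∀ x, X ≤ x → w₁ x * y x - w x * y₁ x = k := by
    intro x hx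
    have h := Convex.norm_image_sub_le_of_norm_hasDerivWithin_le (𝕜 := ℝ)
      (f := fun x => w₁ x * y x - w x * y₁ x) (f' := fun _ => 0) (C := 0) (s := Set.Ici X)
      (x := X) (y := x) (fun z hz => ?_) (by simp) (convex_Ici X) Set.self_mem_Ici hx
    · rw [zero_mul] at h
      exact sub_eq_zero.1 (norm_le_zero_iff.1 h)
    · have hz0 : 0 < z := by have : X ≤ z := hz; linarith
      refine ((((hw₁ z hz0).mul (hy z hz0)).sub ((hw z hz0).mul (hy₁ z hz0))).congr_deriv
        ?_).hasDerivWithinAt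
      ring
  set K : ℝ := ‖k‖ * 4 / ‖L‖ ^ 2 with hK
  have hK0 : 0 ≤ K := by positivity
  have hder : ∀ x, X ≤ x → HasDerivAt (fun x => w x / y x) (k / y x ^ 2) x := fun x hx => by
    have hx0 : 0 < x := by linarith
    rw [← hwr x hx]
    exact (hw x hx0).div (hy x hx0) (hyne x hx)
  have hderb : ∀ x, X ≤ x → ‖k / y x ^ 2‖ ≤ K * Real.exp (-2 * x) := fun x hx => by
    rw [norm_div, norm_pow, hK]
    have h1 : (‖L‖ / 2 * Real.exp x) ^ 2 ≤ ‖y x‖ ^ 2 := by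
      gcongr
      exact (hyb x hx).1
    calc ‖k‖ / ‖y x‖ ^ 2 ≤ ‖k‖ / (‖L‖ / 2 * Real.exp x) ^ 2 := by
          gcongr
      _ = _ := by
          rw [show -2 * x = -(x + x) by ring, Real.exp_neg, Real.exp_add]
          field_simp
          norm_num
  have hlim : Filter.Tendsto (fun x => w x / y x) Filter.atTop (nhds 0) := by
    have h := hw0.div hyL hL
    rw [zero_div] at h
    refine h.congr fun x => ?_
    have := Complex.exp_ne_zero (-x)
    rw [Pi.div_apply, mul_div_mul_left _ _ this]
  have hfb : ∀ x, X ≤ x → ‖w x / y x‖ ≤ K * Real.exp (-2 * x) := by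
    intro x hx
    have hsub : ∀ s, s ∈ Set.Ioi x → X ≤ s := fun s hs => hx.trans (le_of_lt hs)
    have hbd : ∀ s ∈ Set.Ioi x, ‖k / y s ^ 2‖ ≤ K * Real.exp (-x) * Real.exp (-s) := fun s hs => by
      refine (hderb s (hsub s hs)).trans ?_
      rw [mul_assoc, ← Real.exp_add]
      gcongr
      have : x < s := hs
      linarith
    have hbi : IntegrableOn (fun s => K * Real.exp (-x) * Real.exp (-s)) (Set.Ioi x) :=
      (integrableOn_exp_neg_Ioi x).const_mul _
    have hgi : IntegrableOn (fun s => k / y s ^ 2) (Set.Ioi x) := by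
      refine Integrable.mono' hbi ?_ ((ae_restrict_iff' measurableSet_Ioi).2
        (Filter.Eventually.of_forall hbd))
      refine ContinuousOn.aestronglyMeasurable (fun s hs => ?_) measurableSet_Ioi
      have hs' := hsub s hs
      have hc : ContinuousAt y s := (hy s (by linarith)).continuousAt
      exact (continuousAt_const.div (hc.pow 2) (pow_ne_zero 2 (hyne s hs'))).continuousWithinAt
    have h := integral_Ioi_of_hasDerivAt_of_tendsto
      (hder x hx).continuousAt.continuousWithinAt (fun s hs => hder s (hsub s hs)) hgi hlim
    rw [zero_sub] at h
    rw [← norm_neg, ← h]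
    refine (norm_integral_le_of_norm_le hbi ((ae_restrict_iff' measurableSet_Ioi).2
        (Filter.Eventually.of_forall hbd))).trans ?_
    rw [integral_const_mul, integral_exp_neg_Ioi, mul_assoc, ← Real.exp_add]
    apply le_of_eq
    ring_nf
  set B : ℝ := 2 * ‖L‖ * K with hB
  have hB0 : 0 ≤ B := by positivity
  have hwb : ∀ x, X ≤ x → ‖w x‖ ≤ B * Real.exp (-x) := fun x hx => by
    have e : w x = w x / y x * y x := by field_simp [hyne x hx]
    rw [e, norm_mul]
    calc ‖w x / y x‖ * ‖y x‖ ≤ K * Real.exp (-2 * x) * (2 * ‖L‖ * Real.exp x) := by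
          gcongr
          · exact hfb x hx
          · exact (hyb x hx).2
      _ = B * Real.exp (-x) := by
          rw [hB, show -x = -2 * x + x by ring, Real.exp_add]
          ring
  have hQ0 : 0 ≤ Q := (norm_nonneg _).trans (hq 1 le_rfl)
  have hw₁b : ∀ x, X ≤ x → ‖w₁ x‖ ≤ (Q * B + 2 * B) * Real.exp (-x) := by
    intro x hx
    have hdd : ∀ s ∈ Set.Icc x (x + 1), ‖q s * w s‖ ≤ Q * B * Real.exp (-x) := fun s hs => by
      have hs' : X ≤ s := hx.trans hs.1
      rw [norm_mul, mul_assoc]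
      gcongr
      · exact hq s (hX1.trans hs')
      · refine (hwb s hs').trans ?_
        gcongr
        exact hs.1
    have hmem : x ∈ Set.Icc x (x + 1) := ⟨le_rfl, by linarith⟩
    have hd : ∀ s ∈ Set.Icc x (x + 1), ‖w₁ s - w₁ x‖ ≤ Q * B * Real.exp (-x) := fun s hs => by
      have h := Convex.norm_image_sub_le_of_norm_hasDerivWithin_le (𝕜 := ℝ)
        (fun z hz => (hw₁ z (by linarith [hz.1])).hasDerivWithinAt) hdd (convex_Icc x (x + 1))
        hmem hs
      refine h.trans (mul_le_of_le_one_right (by positivity) ?_)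
      rw [Real.norm_eq_abs, abs_of_nonneg (by linarith [hs.1])]
      linarith [hs.2]
    have h := Convex.norm_image_sub_le_of_norm_hasDerivWithin_le (𝕜 := ℝ)
      (f := fun s => w s - s * w₁ x) (f' := fun s => w₁ s - w₁ x)
      (fun z hz => ?_) hd (convex_Icc x (x + 1)) hmem
      (⟨by linarith, le_rfl⟩ : x + 1 ∈ Set.Icc x (x + 1))
    · have e : w₁ x = (w (x + 1) - w x) -
          ((w (x + 1) - ((x + 1 : ℝ) : ℂ) * w₁ x) - (w x - x * w₁ x)) := by
        push_cast; ring
      rw [e]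
      have h1 : ‖w (x + 1)‖ ≤ B * Real.exp (-x) := by
        refine (hwb _ (by linarith)).trans ?_
        gcongr
        linarith
      have h2 := hwb x hx
      have h3 : ‖x + 1 - x‖ = 1 := by simp
      rw [h3, mul_one] at h
      calc _ ≤ ‖w (x + 1) - w x‖ + _ := norm_sub_le _ _
        _ ≤ (‖w (x + 1)‖ + ‖w x‖) + Q * B * Real.exp (-x) := by
            gcongr
            exact norm_sub_le _ _
        _ ≤ _ := by linarith
    · have h1 := (hw z (by linarith [hz.1])).sub
        ((Complex.ofRealCLM.hasDerivAt (x := z)).mul_const (w₁ x))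
      exact (h1.congr_deriv (by simp)).hasDerivWithinAt
  refine ⟨X, Q * B + 2 * B + 1, hX1, by positivity, fun x hx => ⟨?_, ?_⟩⟩
  · refine (hwb x hx).trans (mul_le_mul_of_nonneg_right ?_ (Real.exp_pos _).le)
    have : 0 ≤ Q * B := by positivity
    linarith
  · exact (hw₁b x hx).trans (mul_le_mul_of_nonneg_right (by linarith) (Real.exp_pos _).le)

lemma gam_sq (β : ℝ) : gam β ^ 2 = ((1 / 4 - β ^ 2 : ℝ) : ℂ) := by
  have := Complex.cpow_nat_inv_pow ((1 / 4 - β ^ 2 : ℝ) : ℂ) (n := 2) two_ne_zero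
  have h : (1 : ℂ) / 2 = ((2 : ℕ) : ℂ)⁻¹ := by norm_num
  rw [gam, h]
  exact this

lemma gam_re_nonneg (β : ℝ) : 0 ≤ (gam β).re := by
  rw [gam]
  set z : ℂ := ((1 / 4 - β ^ 2 : ℝ) : ℂ)
  by_cases hz : z = 0
  · rw [hz, Complex.zero_cpow (by norm_num)]; simp
  rw [Complex.cpow_def_of_ne_zero hz, Complex.exp_re]
  have h2 : (Complex.log z * (1 / 2)).im = Complex.arg z / 2 := by
    have : Complex.log z * (1 / 2) = ((1 / 2 : ℝ) : ℂ) * Complex.log z := by push_cast; ring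
    rw [this, Complex.im_ofReal_mul, Complex.log_im]
    ring
  rw [h2]
  refine mul_nonneg (Real.exp_pos _).le (Real.cos_nonneg_of_mem_Icc ⟨?_, ?_⟩)
  · linarith [Complex.neg_pi_lt_arg z]
  · linarith [Complex.arg_le_pi z]

lemma gam_re_lt {β : ℝ} (hβ : 0 < β) : (gam β).re < 1 / 2 := by
  have h := gam_sq β
  have hre := congrArg Complex.re h
  have him := congrArg Complex.im h
  rw [Complex.ofReal_re] at hre
  rw [Complex.ofReal_im] at him
  rw [sq] at hre him
  simp only [Complex.mul_re, Complex.mul_im] at hre him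
  have h0 := gam_re_nonneg β
  by_contra! hcon
  have him0 : (gam β).im = 0 := by
    have : (gam β).re * (gam β).im = 0 := by linarith
    rcases mul_eq_zero.1 this with h1 | h1
    · linarith
    · exact h1
  rw [him0] at hre
  nlinarith [sq_pos_of_pos hβ]

lemma gam_ne_zero {β : ℝ} (hβ4 : β ^ 2 ≠ 1 / 4) : gam β ≠ 0 := by
  intro h
  have h2 := gam_sq β
  rw [h] at h2
  have h3 : (1 / 4 - β ^ 2 : ℝ) = 0 := by
    have : ((1 / 4 - β ^ 2 : ℝ) : ℂ) = 0 := by rw [← h2]; norm_num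
    exact_mod_cast this
  exact hβ4 (by linarith)

lemma two_div_sq_le_exp {x : ℝ} (hx : 0 < x) : Real.exp (-x) ≤ 2 * x ^ (-2 : ℝ) := by
  have h := Real.quadratic_le_exp_of_nonneg hx.le
  rw [Real.exp_neg, Real.rpow_neg hx.le, Real.rpow_two, inv_le_comm₀ (Real.exp_pos x)
    (by positivity), mul_inv, inv_inv]
  linarith

lemma whittaker_type_bounds {w w₁ q : ℝ → ℂ} {κ X D B b : ℝ} (hκ0 : 0 < κ) (hκ1 : κ ≤ 1 / 2)
    (hX1 : 1 ≤ X) (hD0 : 0 < D) (hB0 : 0 < B) (hb : 0 ≤ b)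
    (hqn : ∀ x, 0 < x → ‖q x‖ ≤ 1 + b / x ^ 2)
    (hnear : ∀ x, 0 < x → x ≤ X → ‖w x‖ ≤ D * x ^ κ ∧ ‖w₁ x‖ ≤ D * x ^ (κ - 1))
    (hfar : ∀ x, X ≤ x → ‖w x‖ ≤ B * Real.exp (-x) ∧ ‖w₁ x‖ ≤ B * Real.exp (-x)) :
    ∃ A : ℝ, 0 < A ∧ ∀ x, 0 < x → ‖w x‖ ≤ A * Real.exp (-x) ∧ ‖w x‖ ≤ A * x ^ κ ∧
      ‖w x‖ ≤ A * x ^ (κ - 1) ∧ ‖w₁ x‖ ≤ A * x ^ (κ - 1) ∧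
      ‖w x‖ ≤ A * x ^ (κ - 2) ∧ ‖w₁ x‖ ≤ A * x ^ (κ - 2) ∧ ‖q x * w x‖ ≤ A * x ^ (κ - 2) := by
  set E : ℝ := D * X ^ 2 * Real.exp X + 2 * B with hE
  have hX0 : 0 < X := by linarith
  have hE0 : 0 < E := by positivity
  have hDE : D * X ^ 2 ≤ E := by
    have : D * X ^ 2 * 1 ≤ D * X ^ 2 * Real.exp X := by
      gcongr
      exact Real.one_le_exp hX0.le
    linarith
  have hX2 : X ≤ X ^ 2 := le_self_pow₀ hX1 two_ne_zero
  have key : ∀ x, 0 < x → ‖w x‖ ≤ E * Real.exp (-x) ∧ ‖w x‖ ≤ E * x ^ κ ∧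
      ‖w x‖ ≤ E * x ^ (κ - 1) ∧ ‖w₁ x‖ ≤ E * x ^ (κ - 1) ∧
      ‖w x‖ ≤ E * x ^ (κ - 2) ∧ ‖w₁ x‖ ≤ E * x ^ (κ - 2) := by
    intro x hx
    rcases le_total x X with hxX | hxX
    · obtain ⟨n0, n1⟩ := hnear x hx hxX
      have m1 : x ^ κ ≤ X * x ^ (κ - 1) := by
        rw [show κ = 1 + (κ - 1) by ring, Real.rpow_add hx, Real.rpow_one]
        simp only [add_sub_cancel_left]
        gcongr
      have m2 : x ^ (κ - 1) ≤ X * x ^ (κ - 2) := by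
        rw [show κ - 1 = 1 + (κ - 2) by ring, Real.rpow_add hx, Real.rpow_one]
        gcongr
      have m3 : x ^ κ ≤ X ^ 2 * x ^ (κ - 2) := by nlinarith
      have t0 : 0 ≤ x ^ κ := by positivity
      have t1 : 0 ≤ x ^ (κ - 1) := by positivity
      have t2 : 0 ≤ x ^ (κ - 2) := by positivity
      have d1 : D ≤ D * X ^ 2 := le_mul_of_one_le_right hD0.le (one_le_pow₀ hX1)
      have d2 : D * X ≤ D * X ^ 2 := by gcongr
      refine ⟨?_, ?_, ?_, ?_, ?_, ?_⟩
      · have h1 : x ^ κ ≤ X ^ 2 := by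
          calc x ^ κ ≤ X ^ κ := Real.rpow_le_rpow hx.le hxX hκ0.le
            _ ≤ X ^ (2 : ℝ) := Real.rpow_le_rpow_of_exponent_le hX1 (by linarith)
            _ = X ^ 2 := Real.rpow_two X
        have h2 : 1 ≤ Real.exp X * Real.exp (-x) := by
          rw [← Real.exp_add]; exact Real.one_le_exp (by linarith)
        calc ‖w x‖ ≤ D * X ^ 2 * 1 := by rw [mul_one]; exact n0.trans (by gcongr)
          _ ≤ D * X ^ 2 * (Real.exp X * Real.exp (-x)) := by gcongr
          _ ≤ E * Real.exp (-x) := by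
            rw [hE, ← mul_assoc]
            gcongr
            linarith
      · exact n0.trans (by gcongr; linarith)
      · refine n0.trans ((mul_le_mul_of_nonneg_left m1 hD0.le).trans ?_)
        rw [← mul_assoc]; gcongr; linarith
      · exact n1.trans (by gcongr; linarith)
      · refine n0.trans ((mul_le_mul_of_nonneg_left m3 hD0.le).trans ?_)
        rw [← mul_assoc]; gcongr
      · refine n1.trans ((mul_le_mul_of_nonneg_left m2 hD0.le).trans ?_)
        rw [← mul_assoc]; gcongr; linarith
    · obtain ⟨n0, n1⟩ := hfar x hxX
      have hx1 : 1 ≤ x := hX1.trans hxX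
      have e2 := two_div_sq_le_exp hx
      have hBE : B * 2 ≤ E := by
        have : 0 ≤ D * X ^ 2 * Real.exp X := by positivity
        linarith
      have hpw : ∀ p : ℝ, -2 ≤ p → B * Real.exp (-x) ≤ E * x ^ p := fun p hp => by
        calc B * Real.exp (-x) ≤ B * (2 * x ^ (-2 : ℝ)) := by gcongr
          _ = B * 2 * x ^ (-2 : ℝ) := by ring
          _ ≤ E * x ^ p := by
            gcongr
      refine ⟨n0.trans (by gcongr; linarith), n0.trans (hpw _ ?_), n0.trans (hpw _ ?_),
        n1.trans (hpw _ ?_), n0.trans (hpw _ ?_), n1.trans (hpw _ ?_)⟩ <;> linarith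
  refine ⟨E * (1 + b), by positivity, fun x hx => ?_⟩
  obtain ⟨k0, k1, k2, k3, k4, k5⟩ := key x hx
  have hEE : E ≤ E * (1 + b) := le_mul_of_one_le_right hE0.le (by linarith)
  have hup : ∀ {r p : ℝ}, 0 ≤ p → r ≤ E * p → r ≤ E * (1 + b) * p := fun hp h =>
    h.trans (mul_le_mul_of_nonneg_right hEE hp)
  refine ⟨hup (by positivity) k0, hup (by positivity) k1, hup (by positivity) k2,
    hup (by positivity) k3, hup (by positivity) k4, hup (by positivity) k5, ?_⟩
  rw [norm_mul]
  calc ‖q x‖ * ‖w x‖ ≤ (1 + b / x ^ 2) * ‖w x‖ := by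
        gcongr
        exact hqn x hx
    _ = ‖w x‖ + b * (‖w x‖ / x ^ 2) := by ring
    _ ≤ E * x ^ (κ - 2) + b * (E * x ^ κ / x ^ 2) := by gcongr
    _ = E * (1 + b) * x ^ (κ - 2) := by
        rw [Real.rpow_sub hx, Real.rpow_two]; ring

lemma whittW_bounds {β : ℝ} (hβ : 0 < β) (hβ4 : β ^ 2 ≠ 1 / 4) :
    ∃ (w₁ w₂ : ℝ → ℂ) (A : ℝ), 0 < A ∧ ContinuousOn w₂ (Set.Ioi 0) ∧
      (∀ x, 0 < x → HasDerivAt (fun x : ℝ => whittW (gam β) (2 * (x : ℂ))) (w₁ x) x) ∧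
      (∀ x, 0 < x → HasDerivAt w₁ (w₂ x) x) ∧
      ∀ x : ℝ, 0 < x →
        ‖whittW (gam β) (2 * (x : ℂ))‖ ≤ A * Real.exp (-x) ∧
        ‖whittW (gam β) (2 * (x : ℂ))‖ ≤ A * x ^ (1 / 2 - (gam β).re) ∧
        ‖whittW (gam β) (2 * (x : ℂ))‖ ≤ A * x ^ (1 / 2 - (gam β).re - 1) ∧
        ‖w₁ x‖ ≤ A * x ^ (1 / 2 - (gam β).re - 1) ∧
        ‖whittW (gam β) (2 * (x : ℂ))‖ ≤ A * x ^ (1 / 2 - (gam β).re - 2) ∧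
        ‖w₁ x‖ ≤ A * x ^ (1 / 2 - (gam β).re - 2) ∧
        ‖w₂ x‖ ≤ A * x ^ (1 / 2 - (gam β).re - 2) := by
  have hμ0 := gam_re_nonneg β
  have hμ1 := gam_re_lt hβ
  have hγ0 := gam_ne_zero hβ4
  have hγ2 := gam_sq β
  set γ := gam β with hγ
  set κ : ℝ := 1 / 2 - γ.re with hκ
  have hκ0 : 0 < κ := by linarith
  have hκ1 : κ ≤ 1 / 2 := by linarith
  set a : ℂ := 1 / 2 + γ with ha
  set b : ℂ := 1 / 2 + -γ with hb
  have hare : a.re = 1 / 2 + γ.re := by simp [ha]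
  have hbre : b.re = κ := by simp [hb, hκ]; ring
  have ha0 : 0 < a.re := by linarith
  have hb0 : 0 < b.re := by linarith
  obtain ⟨u₁, hu, hu1, hub⟩ := exists_whittY_deriv ha0
  obtain ⟨v₁, hv, hv1, hvb⟩ := exists_whittY_deriv hb0
  have haq : a * (a - 1) = -((β ^ 2 : ℝ) : ℂ) := by
    rw [ha]
    push_cast at hγ2 ⊢
    linear_combination hγ2
  have hbq : b * (b - 1) = -((β ^ 2 : ℝ) : ℂ) := by
    rw [hb]
    push_cast at hγ2 ⊢
    linear_combination hγ2
  rw [haq] at hu1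
  rw [hbq] at hv1
  set q : ℝ → ℂ := fun x => 1 + -((β ^ 2 : ℝ) : ℂ) / (x : ℂ) ^ 2 with hq
  have hqn : ∀ x : ℝ, 0 < x → ‖q x‖ ≤ 1 + β ^ 2 / x ^ 2 := fun x hx => by
    refine (norm_add_le _ _).trans ?_
    rw [norm_one, norm_div, norm_neg, norm_pow, Complex.norm_real, Complex.norm_real,
      Real.norm_eq_abs, Real.norm_eq_abs, abs_of_pos hx, abs_of_nonneg (sq_nonneg β)]
  set c₁ : ℂ := Complex.Gamma (-(2 * γ)) / Complex.Gamma ((1 : ℂ) / 2 - γ) * 2 ^ a with hc1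
  set c₂ : ℂ := Complex.Gamma (2 * γ) / Complex.Gamma ((1 : ℂ) / 2 + γ) * 2 ^ b with hc2
  set w : ℝ → ℂ := fun x => c₁ * whittY a x + c₂ * whittY b x with hw
  have hweq : ∀ x : ℝ, 0 < x → whittW γ (2 * (x : ℂ)) = w x := fun x hx => by
    rw [whittW, whittM_two_mul γ hx, whittM_two_mul (-γ) hx]
    simp only [hw, hc1, hc2, ha, hb]
    ring
  set w₁ : ℝ → ℂ := fun x => c₁ * u₁ x + c₂ * v₁ x with hw1
  have dw : ∀ x : ℝ, 0 < x → HasDerivAt w (w₁ x) x := fun x hx =>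
    ((hu x hx).const_mul c₁).add ((hv x hx).const_mul c₂)
  have dw1 : ∀ x : ℝ, 0 < x → HasDerivAt w₁ (q x * w x) x := fun x hx =>
    (((hu1 x hx).const_mul c₁).add ((hv1 x hx).const_mul c₂)).congr_deriv
      (by simp only [hw, hq]; ring)
  have hlimw : Filter.Tendsto (fun x : ℝ => Complex.exp (-x) * w x) Filter.atTop (nhds 0) := by
    have h1 := (tendsto_whittY ha0 (by linarith)).const_mul
      (Complex.Gamma (-(2 * γ)) / Complex.Gamma ((1 : ℂ) / 2 - γ))
    have h2 := (tendsto_whittY hb0 (by linarith)).const_mul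
      (Complex.Gamma (2 * γ) / Complex.Gamma ((1 : ℂ) / 2 + γ))
    have h := h1.add h2
    have hz : Complex.Gamma (-(2 * γ)) / Complex.Gamma ((1 : ℂ) / 2 - γ) *
        (Complex.Gamma (2 * a) / Complex.Gamma a) + Complex.Gamma (2 * γ) /
        Complex.Gamma ((1 : ℂ) / 2 + γ) * (Complex.Gamma (2 * b) / Complex.Gamma b) = 0 := by
      have e1 : Complex.Gamma (2 * a) = 2 * γ * Complex.Gamma (2 * γ) := by
        rw [← Complex.Gamma_add_one _ (by simpa using hγ0)]
        congr 1; rw [ha]; ring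
      have e2 : Complex.Gamma (2 * b) = -(2 * γ) * Complex.Gamma (-(2 * γ)) := by
        rw [← Complex.Gamma_add_one _ (by simpa using hγ0)]
        congr 1; rw [hb]; ring
      rw [e1, e2, ← ha, show (1 : ℂ) / 2 - γ = b by rw [hb]; ring]
      ring
    rw [hz] at h
    refine h.congr fun x => ?_
    simp only [hw, hc1, hc2]
    ring
  have hlimy : Filter.Tendsto (fun x : ℝ => Complex.exp (-x) * whittY a x) Filter.atTop
      (nhds ((2 ^ a)⁻¹ * (Complex.Gamma (2 * a) / Complex.Gamma a))) := by
    refine ((tendsto_whittY ha0 (by linarith)).const_mul ((2 : ℂ) ^ a)⁻¹).congr fun x => ?_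
    have : (2 : ℂ) ^ a ≠ 0 := by simp [Complex.cpow_eq_zero_iff]
    field_simp
  have hL0 : ((2 : ℂ) ^ a)⁻¹ * (Complex.Gamma (2 * a) / Complex.Gamma a) ≠ 0 := by
    have h1 : (2 : ℂ) ^ a ≠ 0 := by simp [Complex.cpow_eq_zero_iff]
    have h2 := Complex.Gamma_ne_zero_of_re_pos ha0
    have h3 := Complex.Gamma_ne_zero_of_re_pos (s := 2 * a) (by simpa using ha0)
    positivity
  obtain ⟨X, B, hX1, hB0, hfar⟩ := norm_le_exp_neg_of_recessive (Q := 1 + β ^ 2) hL0 hu hu1 dw dw1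
    (fun x hx => by
      refine (hqn x (by linarith)).trans ?_
      gcongr
      exact div_le_self (sq_nonneg β) (one_le_pow₀ hx))
    hlimy hlimw
  obtain ⟨A₁, hA1, hnear1⟩ := hub X
  obtain ⟨A₂, hA2, hnear2⟩ := hvb X
  set D : ℝ := ‖c₁‖ * A₁ * X + ‖c₂‖ * A₂ + 1 with hD
  have hD0 : 0 < D := by positivity
  have hcmp : ∀ x, 0 < x → x ≤ X → ∀ p : ℝ, x ^ (a.re + p) ≤ X * x ^ (κ + p) := by
    intro x hx hxX p
    rw [show a.re + p = 2 * γ.re + (κ + p) by rw [hare, hκ]; ring, Real.rpow_add hx]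
    gcongr
    calc x ^ (2 * γ.re) ≤ X ^ (2 * γ.re) := Real.rpow_le_rpow hx.le hxX (by linarith)
      _ ≤ X ^ (1 : ℝ) := Real.rpow_le_rpow_of_exponent_le hX1 (by linarith)
      _ = X := Real.rpow_one X
  have hnear : ∀ x, 0 < x → x ≤ X → ‖w x‖ ≤ D * x ^ κ ∧ ‖w₁ x‖ ≤ D * x ^ (κ - 1) := by
    intro x hx hxX
    obtain ⟨p1, p2⟩ := hnear1 x hx hxX
    obtain ⟨r1, r2⟩ := hnear2 x hx hxX
    rw [hbre] at r1 r2
    have s1 := hcmp x hx hxX 0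
    have s2 := hcmp x hx hxX (-1)
    rw [add_zero, add_zero] at s1
    rw [← sub_eq_add_neg, ← sub_eq_add_neg] at s2
    have t1 : 0 ≤ x ^ κ := by positivity
    have t2 : 0 ≤ x ^ (κ - 1) := by positivity
    constructor
    · calc ‖w x‖ ≤ ‖c₁‖ * ‖whittY a x‖ + ‖c₂‖ * ‖whittY b x‖ := by
            rw [← norm_mul, ← norm_mul]; exact norm_add_le _ _
        _ ≤ ‖c₁‖ * (A₁ * (X * x ^ κ)) + ‖c₂‖ * (A₂ * x ^ κ) := by
            gcongr
            exact p1.trans (by gcongr)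
        _ ≤ D * x ^ κ := by rw [hD]; nlinarith
    · calc ‖w₁ x‖ ≤ ‖c₁‖ * ‖u₁ x‖ + ‖c₂‖ * ‖v₁ x‖ := by
            rw [← norm_mul, ← norm_mul]; exact norm_add_le _ _
        _ ≤ ‖c₁‖ * (A₁ * (X * x ^ (κ - 1))) + ‖c₂‖ * (A₂ * x ^ (κ - 1)) := by
            gcongr
            exact p2.trans (by gcongr)
        _ ≤ D * x ^ (κ - 1) := by rw [hD]; nlinarith
  obtain ⟨A, hA, hbounds⟩ := whittaker_type_bounds hκ0 hκ1 hX1 hD0 hB0 (sq_nonneg β) hqn hnear hfar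
  refine ⟨w₁, fun x => q x * w x, A, hA, ?_, fun x hx => ?_, dw1, fun x hx => ?_⟩
  · intro x hx
    have hx0 : (x : ℂ) ≠ 0 := by exact_mod_cast (ne_of_gt hx)
    have hcx : ContinuousAt (fun x : ℝ => (x : ℂ) ^ 2) x := by fun_prop
    exact ((continuousAt_const.add (continuousAt_const.div hcx (pow_ne_zero 2 hx0))).mul
      (dw x hx).continuousAt).continuousWithinAt
  · refine (dw x hx).congr_of_eventuallyEq ?_
    filter_upwards [Ioi_mem_nhds hx] with z hz using hweq z hz
  · rw [hweq x hx]
    exact hbounds x hx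

lemma lintegral_sq_le_measure_mul {α : Type*} [MeasurableSpace α] (ν : Measure α) {f : α → ℝ≥0∞}
    (hf : AEMeasurable f ν) : (∫⁻ s, f s ∂ν) ^ 2 ≤ ν univ * ∫⁻ s, f s ^ 2 ∂ν := by
  have h := ENNReal.lintegral_mul_le_Lp_mul_Lq ν Real.HolderConjugate.two_two hf
    (aemeasurable_const (b := (1 : ℝ≥0∞)))
  simp only [Pi.mul_apply, mul_one, ENNReal.one_rpow, lintegral_const, one_mul] at h
  calc (∫⁻ s, f s ∂ν) ^ 2 ≤ ((∫⁻ s, f s ^ (2 : ℝ) ∂ν) ^ (1 / (2 : ℝ)) * ν univ ^ (1 / (2 : ℝ))) ^ 2 :=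
        pow_le_pow_left' h 2
    _ = ν univ * ∫⁻ s, f s ^ 2 ∂ν := by
        rw [mul_pow, ← ENNReal.rpow_two, ← ENNReal.rpow_two, ← ENNReal.rpow_mul, ← ENNReal.rpow_mul]
        norm_num
        rw [mul_comm]

lemma eLpNorm_two_sq {f : ℝ → ℝ≥0∞} : eLpNorm f 2 volume ^ 2 = ∫⁻ y, f y ^ 2 := by
  rw [eLpNorm_eq_lintegral_rpow_enorm_toReal two_ne_zero ENNReal.ofNat_ne_top, ← ENNReal.rpow_two,
    ← ENNReal.rpow_mul]
  norm_num

lemma eLpNorm_lintegral_translate_le (ν : Measure ℝ) [SFinite ν] {F : ℝ → ℝ≥0∞}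
    (hF : Measurable F) (c : ℝ) :
    eLpNorm (fun y => ∫⁻ s, F (y + c * s) ∂ν) 2 volume ≤ ν univ * eLpNorm F 2 volume := by
  have hm : Measurable (Function.uncurry fun (y s : ℝ) => F (y + c * s) ^ 2) := by
    unfold Function.uncurry
    fun_prop
  have h : eLpNorm (fun y => ∫⁻ s, F (y + c * s) ∂ν) 2 volume ^ 2 ≤
      (ν univ * eLpNorm F 2 volume) ^ 2 := by
    rw [eLpNorm_two_sq, mul_pow, eLpNorm_two_sq]
    calc ∫⁻ y, (∫⁻ s, F (y + c * s) ∂ν) ^ 2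
        ≤ ∫⁻ y, ν univ * ∫⁻ s, F (y + c * s) ^ 2 ∂ν :=
          lintegral_mono fun y => lintegral_sq_le_measure_mul ν (by fun_prop)
      _ = ν univ * ∫⁻ y, ∫⁻ s, F (y + c * s) ^ 2 ∂ν :=
          lintegral_const_mul _ hm.lintegral_prod_right'
      _ = ν univ * ∫⁻ s, (∫⁻ y, F (y + c * s) ^ 2) ∂ν := by
          rw [lintegral_lintegral_swap hm.aemeasurable]
      _ = ν univ * ∫⁻ s, (∫⁻ y, F y ^ 2) ∂ν := by
          congr 1
          refine lintegral_congr fun s => ?_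
          exact lintegral_add_right_eq_self (fun y => F y ^ 2) (c * s)
      _ = ν univ ^ 2 * ∫⁻ y, F y ^ 2 := by
          rw [lintegral_const]; ring
  exact (ENNReal.pow_le_pow_left_iff two_ne_zero).1 h

lemma enorm_integral_exp_mul_le {f f₁ f₂ : ℝ → ℂ} {τ a : ℝ} (hτ : τ ≠ 0) (ha : 0 < a)
    (hf : ∀ x, 0 < x → HasDerivAt f (f₁ x) x) (hf₁ : ∀ x, 0 < x → HasDerivAt f₁ (f₂ x) x)
    (if0 : IntegrableOn f (Ioi 0)) (if1 : IntegrableOn f₁ (Ioi 0)) (if2 : IntegrableOn f₂ (Ioi a))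
    (h0 : Filter.Tendsto f (nhdsWithin 0 (Ioi 0)) (nhds 0))
    (hinf : Filter.Tendsto f Filter.atTop (nhds 0))
    (hinf₁ : Filter.Tendsto f₁ Filter.atTop (nhds 0)) :
    ‖∫ s in Ioi (0 : ℝ), Complex.exp (I * τ * s) * f s‖ₑ ≤
      ENNReal.ofReal |τ|⁻¹ * ((∫⁻ s in Ioc 0 a, ‖f₁ s‖ₑ) +
        ENNReal.ofReal |τ|⁻¹ * (‖f₁ a‖ₑ + ∫⁻ s in Ioi a, ‖f₂ s‖ₑ)) := by
  set e : ℝ → ℂ := fun s => Complex.exp (I * τ * s) with he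
  have hτc : (τ : ℂ) ≠ 0 := by exact_mod_cast hτ
  have hIτ : I * (τ : ℂ) ≠ 0 := mul_ne_zero I_ne_zero hτc
  have hIτn : ‖(I * (τ : ℂ))⁻¹‖ₑ = ENNReal.ofReal |τ|⁻¹ := by
    rw [← ofReal_norm]
    simp
  have hen : ∀ s, ‖e s‖ = 1 := fun s => by
    rw [he]
    have : I * (τ : ℂ) * s = ((τ * s : ℝ) : ℂ) * I := by push_cast; ring
    simp only [this, Complex.norm_exp_ofReal_mul_I]
  have hde : ∀ s : ℝ, HasDerivAt (fun s => (I * (τ : ℂ))⁻¹ * e s) (e s) s := fun s => by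
    have h1 : HasDerivAt (fun s : ℝ => I * (τ : ℂ) * s) (I * (τ : ℂ) * 1) s :=
      (Complex.ofRealCLM.hasDerivAt (x := s)).const_mul _
    refine (h1.cexp.const_mul (I * (τ : ℂ))⁻¹).congr_deriv ?_
    simp only [he]
    field_simp
  have hec : Continuous e := by fun_prop
  have hgi : ∀ {g : ℝ → ℂ} {S : Set ℝ}, IntegrableOn g S → IntegrableOn (g * e) S :=
    fun hg => hg.mul_bdd (c := 1) hec.aestronglyMeasurable
      (Filter.Eventually.of_forall fun x => (hen x).le)
  have hgi' : ∀ {g : ℝ → ℂ} {S : Set ℝ}, IntegrableOn g S →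
      IntegrableOn (g * fun s => (I * (τ : ℂ))⁻¹ * e s) S := fun hg => by
    refine ((hgi hg).const_mul (I * (τ : ℂ))⁻¹).congr (Filter.Eventually.of_forall fun x => ?_)
    simp only [Pi.mul_apply]; ring
  have hlim : ∀ {g : ℝ → ℂ} {l : Filter ℝ}, Filter.Tendsto g l (nhds 0) →
      Filter.Tendsto (g * fun s => (I * (τ : ℂ))⁻¹ * e s) l (nhds 0) := fun {g l} hg => by
    rw [tendsto_zero_iff_norm_tendsto_zero] at hg ⊢
    have := hg.mul_const ‖(I * (τ : ℂ))⁻¹‖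
    rw [zero_mul] at this
    refine this.congr fun x => ?_
    simp [hen]
  have hpull : ∀ (g : ℝ → ℂ) (S : Set ℝ), ∫ s in S, g s * ((I * (τ : ℂ))⁻¹ * e s) =
      (I * (τ : ℂ))⁻¹ * ∫ s in S, g s * e s := fun g S => by
    rw [← integral_const_mul]
    congr 1 with s
    ring
  have step₁ : ∫ s in Ioi (0 : ℝ), f s * e s = -((I * (τ : ℂ))⁻¹ * ∫ s in Ioi 0, f₁ s * e s) := by
    rw [integral_Ioi_mul_deriv_eq_deriv_mul (fun x hx => hf x hx) (fun x _ => hde x) (hgi if0)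
      (hgi' if1) (hlim h0) (hlim hinf), hpull]
    ring
  have hcont : Filter.Tendsto (f₁ * fun s => (I * (τ : ℂ))⁻¹ * e s) (nhdsWithin a (Ioi a))
      (nhds (f₁ a * ((I * (τ : ℂ))⁻¹ * e a))) :=
    ((hf₁ a ha).continuousAt.mul (hde a).continuousAt).continuousWithinAt
  have step₂ : ∫ s in Ioi a, f₁ s * e s =
      -((I * (τ : ℂ))⁻¹ * (f₁ a * e a + ∫ s in Ioi a, f₂ s * e s)) := by
    rw [integral_Ioi_mul_deriv_eq_deriv_mul (fun x hx => hf₁ x (ha.trans hx)) (fun x _ => hde x)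
      (hgi (if1.mono_set (Ioi_subset_Ioi ha.le))) (hgi' if2) hcont (hlim hinf₁), hpull]
    ring
  have hsplit : ∫ s in Ioi (0 : ℝ), f₁ s * e s =
      (∫ s in Ioc 0 a, f₁ s * e s) + ∫ s in Ioi a, f₁ s * e s := by
    rw [← Ioc_union_Ioi_eq_Ioi ha.le]
    exact setIntegral_union Ioc_disjoint_Ioi_same measurableSet_Ioi
      (hgi (if1.mono_set Ioc_subset_Ioi_self)) (hgi (if1.mono_set (Ioi_subset_Ioi ha.le)))
  have hnn : ∀ s, ‖e s‖ₑ = 1 := fun s => by rw [← ofReal_norm, hen, ENNReal.ofReal_one]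
  have hle : ∀ (g : ℝ → ℂ) (S : Set ℝ), ‖∫ s in S, g s * e s‖ₑ ≤ ∫⁻ s in S, ‖g s‖ₑ := fun g S => by
    refine (enorm_integral_le_lintegral_enorm _).trans_eq ?_
    simp only [enorm_mul, hnn, mul_one]
  calc ‖∫ s in Ioi (0 : ℝ), Complex.exp (I * τ * s) * f s‖ₑ
      = ‖∫ s in Ioi (0 : ℝ), f s * e s‖ₑ := by
        congr 2 with s
        rw [mul_comm]
    _ = ENNReal.ofReal |τ|⁻¹ * ‖(∫ s in Ioc 0 a, f₁ s * e s) + ∫ s in Ioi a, f₁ s * e s‖ₑ := by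
        rw [step₁, enorm_neg, enorm_mul, hIτn, hsplit]
    _ ≤ ENNReal.ofReal |τ|⁻¹ * (‖∫ s in Ioc 0 a, f₁ s * e s‖ₑ + ‖∫ s in Ioi a, f₁ s * e s‖ₑ) := by
        gcongr
        exact enorm_add_le _ _
    _ = ENNReal.ofReal |τ|⁻¹ * (‖∫ s in Ioc 0 a, f₁ s * e s‖ₑ +
        ENNReal.ofReal |τ|⁻¹ * ‖f₁ a * e a + ∫ s in Ioi a, f₂ s * e s‖ₑ) := by
        rw [step₂, enorm_neg, enorm_mul, hIτn]
    _ ≤ _ := by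
        gcongr
        · exact hle _ _
        · refine (enorm_add_le _ _).trans ?_
          rw [enorm_mul, hnn, mul_one]
          gcongr
          exact hle _ _

def oscMeasure (κ t : ℝ) : Measure ℝ :=
  ENNReal.ofReal t⁻¹ •
      (volume.restrict (Ioc 0 t⁻¹)).withDensity (fun s => ENNReal.ofReal (s ^ (κ - 1))) +
    ENNReal.ofReal (t ^ (-1 - κ)) • Measure.dirac t⁻¹ +
    ENNReal.ofReal (t ^ (-2 : ℝ)) •
      (volume.restrict (Ioi t⁻¹)).withDensity (fun s => ENNReal.ofReal (s ^ (κ - 2)))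

lemma lintegral_oscMeasure (κ t : ℝ) {S : ℝ → ℝ≥0∞} (hS : Measurable S) :
    ∫⁻ s, S s ∂oscMeasure κ t =
      ENNReal.ofReal t⁻¹ * (∫⁻ s in Ioc 0 t⁻¹, ENNReal.ofReal (s ^ (κ - 1)) * S s) +
        ENNReal.ofReal (t ^ (-1 - κ)) * S t⁻¹ +
        ENNReal.ofReal (t ^ (-2 : ℝ)) * ∫⁻ s in Ioi t⁻¹, ENNReal.ofReal (s ^ (κ - 2)) * S s := by
  rw [oscMeasure, lintegral_add_measure, lintegral_add_measure, lintegral_smul_measure,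
    lintegral_smul_measure, lintegral_smul_measure, lintegral_dirac' _ hS,
    lintegral_withDensity_eq_lintegral_mul _ (by fun_prop) hS,
    lintegral_withDensity_eq_lintegral_mul _ (by fun_prop) hS]
  simp only [Pi.mul_apply, smul_eq_mul]

lemma oscMeasure_univ {κ t : ℝ} (hκ0 : 0 < κ) (hκ1 : κ < 1) (ht : 0 < t) :
    oscMeasure κ t univ = ENNReal.ofReal ((1 / κ + 1 + 1 / (1 - κ)) * t ^ (-1 - κ)) := by
  have hti : 0 < t⁻¹ := inv_pos.2 ht
  have h := lintegral_oscMeasure κ t (S := fun _ => 1) measurable_const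
  rw [lintegral_one] at h
  simp only [mul_one] at h
  have i1 : ∫⁻ s in Ioc 0 t⁻¹, ENNReal.ofReal (s ^ (κ - 1)) = ENNReal.ofReal (t⁻¹ ^ κ / κ) := by
    have hi : IntegrableOn (fun s : ℝ => s ^ (κ - 1)) (Ioc 0 t⁻¹) :=
      (intervalIntegrable_iff_integrableOn_Ioc_of_le hti.le).1
        (intervalIntegral.intervalIntegrable_rpow' (by linarith))
    rw [← ofReal_integral_eq_lintegral_ofReal hi ((ae_restrict_iff' measurableSet_Ioc).2
      (Filter.Eventually.of_forall fun x hx => Real.rpow_nonneg hx.1.le _)),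
      ← intervalIntegral.integral_of_le hti.le, integral_rpow (Or.inl (by linarith))]
    congr 1
    rw [Real.zero_rpow (by linarith)]
    simp
  have i2 : ∫⁻ s in Ioi t⁻¹, ENNReal.ofReal (s ^ (κ - 2)) =
      ENNReal.ofReal (t⁻¹ ^ (κ - 1) / (1 - κ)) := by
    rw [← ofReal_integral_eq_lintegral_ofReal (integrableOn_Ioi_rpow_of_lt (by linarith) hti)
      ((ae_restrict_iff' measurableSet_Ioi).2
      (Filter.Eventually.of_forall fun x hx => Real.rpow_nonneg (hti.trans hx).le _)),
      integral_Ioi_rpow_of_lt (by linarith) hti]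
    congr 1
    rw [show κ - 2 + 1 = -(1 - κ) by ring, neg_div_neg_eq, show -(1 - κ) = κ - 1 by ring]
  have hk : 0 < 1 - κ := by linarith
  rw [h, i1, i2, ← ENNReal.ofReal_mul hti.le, ← ENNReal.ofReal_mul (by positivity),
    ← ENNReal.ofReal_add (by positivity) (by positivity),
    ← ENNReal.ofReal_add (by positivity) (by positivity)]
  congr 1
  have e1 : t⁻¹ * (t⁻¹ ^ κ / κ) = t ^ (-1 - κ) / κ := by
    rw [Real.inv_rpow ht.le, ← Real.rpow_neg ht.le, sub_eq_add_neg, Real.rpow_add ht,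
      Real.rpow_neg_one]
    ring
  have e2 : t ^ (-2 : ℝ) * (t⁻¹ ^ (κ - 1) / (1 - κ)) = t ^ (-1 - κ) / (1 - κ) := by
    rw [Real.inv_rpow ht.le, ← Real.rpow_neg ht.le, show -1 - κ = -2 + -(κ - 1) by ring,
      Real.rpow_add ht]
    ring
  rw [e1, e2]
  ring

lemma enorm_integral_exp_mul_mul_le {w w₁ w₂ h h₁ h₂ : ℝ → ℂ} {κ A K τ : ℝ} (hκ0 : 0 < κ)
    (hκ1 : κ < 1) (hτ : τ ≠ 0) (hA : 0 < A) (cw₂ : ContinuousOn w₂ (Ioi 0))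
    (dw : ∀ x, 0 < x → HasDerivAt w (w₁ x) x) (dw₁ : ∀ x, 0 < x → HasDerivAt w₁ (w₂ x) x)
    (bw : ∀ x : ℝ, 0 < x → ‖w x‖ ≤ A * Real.exp (-x) ∧ ‖w x‖ ≤ A * x ^ κ ∧
      ‖w x‖ ≤ A * x ^ (κ - 1) ∧ ‖w₁ x‖ ≤ A * x ^ (κ - 1) ∧ ‖w x‖ ≤ A * x ^ (κ - 2) ∧
      ‖w₁ x‖ ≤ A * x ^ (κ - 2) ∧ ‖w₂ x‖ ≤ A * x ^ (κ - 2))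
    (dh : ∀ x, HasDerivAt h (h₁ x) x) (dh₁ : ∀ x, HasDerivAt h₁ (h₂ x) x) (ch₂ : Continuous h₂)
    (bh : ∀ x, ‖h x‖ ≤ K ∧ ‖h₁ x‖ ≤ K ∧ ‖h₂ x‖ ≤ K) :
    ‖∫ s in Ioi (0 : ℝ), Complex.exp (I * τ * s) * (w s * h s)‖ₑ ≤
      ENNReal.ofReal (2 * A) * ∫⁻ s, (‖h s‖ₑ + ‖h₁ s‖ₑ + ‖h₂ s‖ₑ) ∂oscMeasure κ |τ| := by
  have ht : 0 < |τ| := abs_pos.2 hτ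
  set t := |τ|
  have hti : 0 < t⁻¹ := inv_pos.2 ht
  have ch : Continuous h := continuous_iff_continuousAt.2 fun x => (dh x).continuousAt
  have ch₁ : Continuous h₁ := continuous_iff_continuousAt.2 fun x => (dh₁ x).continuousAt
  have cw : ContinuousOn w (Ioi 0) := fun x hx => (dw x hx).continuousAt.continuousWithinAt
  have cw₁ : ContinuousOn w₁ (Ioi 0) := fun x hx => (dw₁ x hx).continuousAt.continuousWithinAt
  set f : ℝ → ℂ := fun x => w x * h x with hf
  set f₁ : ℝ → ℂ := fun x => w₁ x * h x + w x * h₁ x with hf₁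
  set f₂ : ℝ → ℂ := fun x => w₂ x * h x + w₁ x * h₁ x + (w₁ x * h₁ x + w x * h₂ x) with hf₂
  have df : ∀ x, 0 < x → HasDerivAt f (f₁ x) x := fun x hx => (dw x hx).mul (dh x)
  have df₁ : ∀ x, 0 < x → HasDerivAt f₁ (f₂ x) x := fun x hx =>
    ((dw₁ x hx).mul (dh x)).add ((dw x hx).mul (dh₁ x))
  have cf : ContinuousOn f (Ioi 0) := cw.mul ch.continuousOn
  have cf₁ : ContinuousOn f₁ (Ioi 0) := (cw₁.mul ch.continuousOn).add (cw.mul ch₁.continuousOn)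
  have cf₂ : ContinuousOn f₂ (Ioi 0) :=
    ((cw₂.mul ch.continuousOn).add (cw₁.mul ch₁.continuousOn)).add
      ((cw₁.mul ch₁.continuousOn).add (cw.mul ch₂.continuousOn))
  have f₁le : ∀ x p : ℝ, ‖w x‖ ≤ A * p → ‖w₁ x‖ ≤ A * p →
      ‖f₁ x‖ ≤ 2 * A * p * (‖h x‖ + ‖h₁ x‖ + ‖h₂ x‖) := fun x p h0 h1 => by
    have hp : 0 ≤ A * p := (norm_nonneg _).trans h0
    calc ‖f₁ x‖ ≤ ‖w₁ x‖ * ‖h x‖ + ‖w x‖ * ‖h₁ x‖ := by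
          rw [← norm_mul, ← norm_mul]; exact norm_add_le _ _
      _ ≤ A * p * ‖h x‖ + A * p * ‖h₁ x‖ := by gcongr
      _ ≤ 2 * A * p * (‖h x‖ + ‖h₁ x‖ + ‖h₂ x‖) := by
          have := mul_nonneg hp (norm_nonneg (h x))
          have := mul_nonneg hp (norm_nonneg (h₁ x))
          have := mul_nonneg hp (norm_nonneg (h₂ x))
          linarith
  have f₂le : ∀ x p : ℝ, ‖w x‖ ≤ A * p → ‖w₁ x‖ ≤ A * p → ‖w₂ x‖ ≤ A * p →
      ‖f₂ x‖ ≤ 2 * A * p * (‖h x‖ + ‖h₁ x‖ + ‖h₂ x‖) := fun x p h0 h1 h2 => by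
    have hp : 0 ≤ A * p := (norm_nonneg _).trans h0
    calc ‖f₂ x‖ ≤ ‖w₂ x‖ * ‖h x‖ + ‖w₁ x‖ * ‖h₁ x‖ + (‖w₁ x‖ * ‖h₁ x‖ + ‖w x‖ * ‖h₂ x‖) := by
          rw [← norm_mul, ← norm_mul, ← norm_mul]
          exact (norm_add_le _ _).trans (add_le_add (norm_add_le _ _) (norm_add_le _ _))
      _ ≤ A * p * ‖h x‖ + A * p * ‖h₁ x‖ + (A * p * ‖h₁ x‖ + A * p * ‖h₂ x‖) := by gcongr
      _ ≤ 2 * A * p * (‖h x‖ + ‖h₁ x‖ + ‖h₂ x‖) := by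
          have := mul_nonneg hp (norm_nonneg (h x))
          have := mul_nonneg hp (norm_nonneg (h₁ x))
          have := mul_nonneg hp (norm_nonneg (h₂ x))
          linarith
  have hS : ∀ x, ‖h x‖ + ‖h₁ x‖ + ‖h₂ x‖ ≤ 3 * K := fun x => by
    obtain ⟨b0, b1, b2⟩ := bh x
    linarith
  have f₁K : ∀ x p : ℝ, ‖w x‖ ≤ A * p → ‖w₁ x‖ ≤ A * p → ‖f₁ x‖ ≤ 2 * A * (3 * K) * p :=
    fun x p h0 h1 => (f₁le x p h0 h1).trans (by
      have hp : 0 ≤ A * p := (norm_nonneg _).trans h0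
      nlinarith [mul_le_mul_of_nonneg_left (hS x) hp])
  have if0 : IntegrableOn f (Ioi 0) := by
    have hi : IntegrableOn (fun x : ℝ => A * K * Real.exp (-x)) (Ioi 0) :=
      (integrableOn_exp_neg_Ioi 0).const_mul _
    refine Integrable.mono' hi (cf.aestronglyMeasurable measurableSet_Ioi)
      ((ae_restrict_iff' measurableSet_Ioi).2 (Filter.Eventually.of_forall fun x hx => ?_))
    rw [norm_mul]
    calc ‖w x‖ * ‖h x‖ ≤ A * Real.exp (-x) * K := by
          gcongr
          · exact (bw x hx).1
          · exact (bh x).1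
      _ = _ := by ring
  have if1 : IntegrableOn f₁ (Ioi 0) := by
    rw [← Ioc_union_Ioi_eq_Ioi (zero_le_one (α := ℝ))]
    refine IntegrableOn.union ?_ ?_
    · have hi : IntegrableOn (fun s : ℝ => s ^ (κ - 1)) (Ioc 0 1) :=
        (intervalIntegrable_iff_integrableOn_Ioc_of_le zero_le_one).1
          (intervalIntegral.intervalIntegrable_rpow' (by linarith))
      refine Integrable.mono' (hi.const_mul (2 * A * (3 * K)))
        ((cf₁.mono Ioc_subset_Ioi_self).aestronglyMeasurable measurableSet_Ioc)
        ((ae_restrict_iff' measurableSet_Ioc).2 (Filter.Eventually.of_forall fun x hx => ?_))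
      obtain ⟨-, -, a1, a2, -⟩ := bw x hx.1
      exact f₁K x _ a1 a2
    · have hi : IntegrableOn (fun s : ℝ => s ^ (κ - 2)) (Ioi 1) :=
        integrableOn_Ioi_rpow_of_lt (by linarith) one_pos
      refine Integrable.mono' (hi.const_mul (2 * A * (3 * K)))
        ((cf₁.mono (Ioi_subset_Ioi zero_le_one)).aestronglyMeasurable measurableSet_Ioi)
        ((ae_restrict_iff' measurableSet_Ioi).2 (Filter.Eventually.of_forall fun x hx => ?_))
      obtain ⟨-, -, -, -, a1, a2, -⟩ := bw x (one_pos.trans hx)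
      exact f₁K x _ a1 a2
  have if2 : IntegrableOn f₂ (Ioi t⁻¹) := by
    have hi : IntegrableOn (fun s : ℝ => s ^ (κ - 2)) (Ioi t⁻¹) :=
      integrableOn_Ioi_rpow_of_lt (by linarith) hti
    refine Integrable.mono' (hi.const_mul (2 * A * (3 * K)))
      ((cf₂.mono (Ioi_subset_Ioi hti.le)).aestronglyMeasurable measurableSet_Ioi)
      ((ae_restrict_iff' measurableSet_Ioi).2 (Filter.Eventually.of_forall fun x hx => ?_))
    obtain ⟨-, -, -, -, a1, a2, a3⟩ := bw x (hti.trans hx)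
    refine (f₂le x _ a1 a2 a3).trans ?_
    have hp : 0 ≤ A * x ^ (κ - 2) := (norm_nonneg _).trans a1
    nlinarith [mul_le_mul_of_nonneg_left (hS x) hp]
  have flim : ∀ {l : Filter ℝ} {p : ℝ → ℝ}, (∀ᶠ x in l, ‖w x‖ ≤ A * p x) →
      Filter.Tendsto p l (nhds 0) → Filter.Tendsto f l (nhds 0) := fun {l p} hp hl => by
    have h1 : Filter.Tendsto (fun x => A * K * p x) l (nhds 0) := by
      simpa using hl.const_mul (A * K)
    refine squeeze_zero_norm' ?_ h1
    filter_upwards [hp] with x hx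
    rw [norm_mul]
    calc ‖w x‖ * ‖h x‖ ≤ A * p x * K :=
          mul_le_mul hx (bh x).1 (norm_nonneg _) ((norm_nonneg _).trans hx)
      _ = _ := by ring
  have h0 : Filter.Tendsto f (nhdsWithin 0 (Ioi 0)) (nhds 0) := by
    refine flim (p := fun x => x ^ κ) ?_ ?_
    · filter_upwards [self_mem_nhdsWithin] with x hx using (bw x hx).2.1
    · have := (Real.continuousAt_rpow_const 0 κ (Or.inr hκ0.le)).tendsto
      rw [Real.zero_rpow hκ0.ne'] at this
      exact this.mono_left nhdsWithin_le_nhds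
  have hinf : Filter.Tendsto f Filter.atTop (nhds 0) := by
    refine flim (p := fun x => Real.exp (-x)) ?_ Real.tendsto_exp_neg_atTop_nhds_zero
    filter_upwards [Filter.eventually_gt_atTop 0] with x hx using (bw x hx).1
  have hinf₁ : Filter.Tendsto f₁ Filter.atTop (nhds 0) := by
    have h1 : Filter.Tendsto (fun x : ℝ => 2 * A * (3 * K) * x ^ (-(1 - κ))) Filter.atTop
        (nhds 0) := by
      simpa using (tendsto_rpow_neg_atTop (show 0 < 1 - κ by linarith)).const_mul (2 * A * (3 * K))
    refine squeeze_zero_norm' ?_ h1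
    filter_upwards [Filter.eventually_gt_atTop 0] with x hx
    obtain ⟨-, -, a1, a2, -⟩ := bw x hx
    rw [show -(1 - κ) = κ - 1 by ring]
    exact f₁K x _ a1 a2
  set S : ℝ → ℝ≥0∞ := fun s => ‖h s‖ₑ + ‖h₁ s‖ₑ + ‖h₂ s‖ₑ with hSdef
  have hSm : Measurable S := by
    simp only [hSdef]
    fun_prop
  have enle : ∀ (z : ℂ) (p x : ℝ), 0 ≤ p → ‖z‖ ≤ 2 * A * p * (‖h x‖ + ‖h₁ x‖ + ‖h₂ x‖) →
      ‖z‖ₑ ≤ ENNReal.ofReal (2 * A) * (ENNReal.ofReal p * S x) := fun z p x hp hz => by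
    rw [← ofReal_norm]
    refine (ENNReal.ofReal_le_ofReal hz).trans_eq ?_
    rw [ENNReal.ofReal_mul (by positivity), ENNReal.ofReal_mul (by positivity),
      ENNReal.ofReal_add (by positivity) (by positivity),
      ENNReal.ofReal_add (by positivity) (by positivity), ofReal_norm, ofReal_norm, ofReal_norm,
      mul_assoc]
  refine (enorm_integral_exp_mul_le hτ hti df df₁ if0 if1 if2 h0 hinf hinf₁).trans ?_
  have b1 : ∫⁻ s in Ioc 0 t⁻¹, ‖f₁ s‖ₑ ≤
      ENNReal.ofReal (2 * A) * ∫⁻ s in Ioc 0 t⁻¹, ENNReal.ofReal (s ^ (κ - 1)) * S s := by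
    rw [← lintegral_const_mul _ (by fun_prop)]
    refine setLIntegral_mono (by fun_prop) fun s hs => ?_
    obtain ⟨-, -, a1, a2, -⟩ := bw s hs.1
    exact enle _ _ _ (Real.rpow_nonneg hs.1.le _) (f₁le s _ a1 a2)
  have b2 : ‖f₁ t⁻¹‖ₑ ≤ ENNReal.ofReal (2 * A) * (ENNReal.ofReal (t⁻¹ ^ (κ - 1)) * S t⁻¹) := by
    obtain ⟨-, -, a1, a2, -⟩ := bw _ hti
    exact enle _ _ _ (Real.rpow_nonneg hti.le _) (f₁le _ _ a1 a2)
  have b3 : ∫⁻ s in Ioi t⁻¹, ‖f₂ s‖ₑ ≤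
      ENNReal.ofReal (2 * A) * ∫⁻ s in Ioi t⁻¹, ENNReal.ofReal (s ^ (κ - 2)) * S s := by
    rw [← lintegral_const_mul _ (by fun_prop)]
    refine setLIntegral_mono (by fun_prop) fun s hs => ?_
    obtain ⟨-, -, -, -, a1, a2, a3⟩ := bw s (hti.trans hs)
    exact enle _ _ _ (Real.rpow_nonneg (hti.trans hs).le _) (f₂le s _ a1 a2 a3)
  have e1 : ENNReal.ofReal (t ^ (-1 - κ)) =
      ENNReal.ofReal t⁻¹ * ENNReal.ofReal t⁻¹ * ENNReal.ofReal (t⁻¹ ^ (κ - 1)) := by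
    rw [← ENNReal.ofReal_mul hti.le, ← ENNReal.ofReal_mul (by positivity), Real.inv_rpow ht.le,
      ← Real.rpow_neg ht.le, show -1 - κ = -1 + -1 + -(κ - 1) by ring, Real.rpow_add ht,
      Real.rpow_add ht, Real.rpow_neg_one]
  have e2 : ENNReal.ofReal (t ^ (-2 : ℝ)) = ENNReal.ofReal t⁻¹ * ENNReal.ofReal t⁻¹ := by
    rw [← ENNReal.ofReal_mul hti.le, show (-2 : ℝ) = -1 + -1 by norm_num, Real.rpow_add ht,
      Real.rpow_neg_one]
  rw [lintegral_oscMeasure κ t hSm, e1, e2]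
  refine (mul_le_mul_right (add_le_add b1 (mul_le_mul_right (add_le_add b2 b3) _)) _).trans_eq ?_
  ring

def expMeasure : Measure ℝ :=
  (volume.restrict (Ioi 0)).withDensity fun x => ENNReal.ofReal (Real.exp (-(1 / 2) * x))

instance : SFinite expMeasure := by unfold expMeasure; infer_instance

instance (κ t : ℝ) : SFinite (oscMeasure κ t) := by unfold oscMeasure; infer_instance

lemma expMeasure_univ : expMeasure univ = 2 := by
  rw [expMeasure, withDensity_apply _ MeasurableSet.univ, Measure.restrict_univ,
    ← ofReal_integral_eq_lintegral_ofReal (exp_neg_integrableOn_Ioi 0 (by norm_num))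
      (Filter.Eventually.of_forall fun x => (Real.exp_pos _).le),
    integral_exp_mul_Ioi (by norm_num)]
  norm_num

def profileConv (w : ℝ → ℂ) (b : ℂ) (c : ℝ) (p q : ℝ → ℂ) (z : ℝ) : ℂ :=
  ∫ x in Ioi (0 : ℝ), w x * (p (z + c * x) - b * x * q (z + c * x))

section profileConv

variable {w p q p' q' : ℝ → ℂ} {b : ℂ} {c A M : ℝ}

lemma norm_profile_integrand_le (bw : ∀ x : ℝ, 0 < x → ‖w x‖ ≤ A * Real.exp (-x)) {x : ℝ}
    (hx : 0 < x) (u v : ℂ) :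
    ‖w x * (u - b * x * v)‖ ≤ 2 * A * (1 + ‖b‖) * Real.exp (-(1 / 2) * x) * (‖u‖ + ‖v‖) := by
  have h0 := bw x hx
  have hA : 0 ≤ A := by
    by_contra! hA
    have := mul_neg_of_neg_of_pos hA (Real.exp_pos (-x))
    linarith [norm_nonneg (w x)]
  have he : (1 + x) * Real.exp (-x) ≤ 2 * Real.exp (-(1 / 2) * x) := by
    have h1 : 1 + x ≤ 2 * Real.exp (1 / 2 * x) := by linarith [Real.add_one_le_exp (1 / 2 * x)]
    calc (1 + x) * Real.exp (-x) ≤ 2 * Real.exp (1 / 2 * x) * Real.exp (-x) := by gcongr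
      _ = 2 * Real.exp (-(1 / 2) * x) := by
        rw [mul_assoc, ← Real.exp_add]; ring_nf
  have h2 : ‖u - b * x * v‖ ≤ (1 + ‖b‖) * (1 + x) * (‖u‖ + ‖v‖) := by
    calc ‖u - b * x * v‖ ≤ ‖u‖ + ‖b‖ * x * ‖v‖ := by
          refine (norm_sub_le _ _).trans ?_
          rw [norm_mul, norm_mul, Complex.norm_real, Real.norm_of_nonneg hx.le]
      _ ≤ (1 + ‖b‖) * (1 + x) * (‖u‖ + ‖v‖) := by
          have k1 : 1 ≤ (1 + ‖b‖) * (1 + x) := by nlinarith [norm_nonneg b]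
          have k2 : ‖b‖ * x ≤ (1 + ‖b‖) * (1 + x) := by nlinarith [norm_nonneg b]
          nlinarith [mul_le_mul_of_nonneg_right k1 (norm_nonneg u),
            mul_le_mul_of_nonneg_right k2 (norm_nonneg v)]
  rw [norm_mul]
  calc ‖w x‖ * ‖u - b * x * v‖
      ≤ A * Real.exp (-x) * ((1 + ‖b‖) * (1 + x) * (‖u‖ + ‖v‖)) := by gcongr
    _ = A * (1 + ‖b‖) * ((1 + x) * Real.exp (-x)) * (‖u‖ + ‖v‖) := by ring
    _ ≤ A * (1 + ‖b‖) * (2 * Real.exp (-(1 / 2) * x)) * (‖u‖ + ‖v‖) := by gcongr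
    _ = _ := by ring

lemma profile_integrand_aestronglyMeasurable (cw : ContinuousOn w (Ioi 0)) (cp : Continuous p)
    (cq : Continuous q) (z : ℝ) :
    AEStronglyMeasurable (fun x : ℝ => w x * (p (z + c * x) - b * x * q (z + c * x)))
      (volume.restrict (Ioi 0)) :=
  (cw.mul (by fun_prop)).aestronglyMeasurable measurableSet_Ioi

lemma hasDerivAt_profileConv (cw : ContinuousOn w (Ioi 0))
    (bw : ∀ x : ℝ, 0 < x → ‖w x‖ ≤ A * Real.exp (-x))
    (dp : ∀ z, HasDerivAt p (p' z) z) (dq : ∀ z, HasDerivAt q (q' z) z)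
    (cp' : Continuous p') (cq' : Continuous q')
    (bp : ∀ z, ‖p z‖ ≤ M) (bq : ∀ z, ‖q z‖ ≤ M) (bp' : ∀ z, ‖p' z‖ ≤ M) (bq' : ∀ z, ‖q' z‖ ≤ M)
    (z : ℝ) : HasDerivAt (profileConv w b c p q) (profileConv w b c p' q' z) z := by
  have cp : Continuous p := continuous_iff_continuousAt.2 fun x => (dp x).continuousAt
  have cq : Continuous q := continuous_iff_continuousAt.2 fun x => (dq x).continuousAt
  have hA : 0 ≤ A := by
    by_contra! hA
    have := mul_neg_of_neg_of_pos hA (Real.exp_pos (-1))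
    linarith [norm_nonneg (w 1), bw 1 one_pos]
  have hi : IntegrableOn (fun x : ℝ => 2 * A * (1 + ‖b‖) * Real.exp (-(1 / 2) * x) * (M + M))
      (Ioi 0) := ((exp_neg_integrableOn_Ioi 0 (by norm_num)).const_mul _).mul_const _
  have hle : ∀ {u v : ℝ → ℂ} (x : ℝ), 0 < x → (∀ z, ‖u z‖ ≤ M) → (∀ z, ‖v z‖ ≤ M) → ∀ y : ℝ,
      ‖w x * (u (y + c * x) - b * x * v (y + c * x))‖ ≤
        2 * A * (1 + ‖b‖) * Real.exp (-(1 / 2) * x) * (M + M) := fun x hx hu hv y =>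
    (norm_profile_integrand_le bw hx _ _).trans (by gcongr <;> [exact hu _; exact hv _])
  refine (hasDerivAt_integral_of_dominated_loc_of_deriv_le (s := univ) Filter.univ_mem
    (F := fun z x => w x * (p (z + c * x) - b * x * q (z + c * x)))
    (F' := fun z x => w x * (p' (z + c * x) - b * x * q' (z + c * x)))
    (Filter.Eventually.of_forall fun y => profile_integrand_aestronglyMeasurable cw cp cq y)
    (Integrable.mono' hi (profile_integrand_aestronglyMeasurable cw cp cq z) ?_)
    (profile_integrand_aestronglyMeasurable cw cp' cq' z) ?_ hi ?_).2
  · exact (ae_restrict_iff' measurableSet_Ioi).2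
      (Filter.Eventually.of_forall fun x hx => hle x hx bp bq z)
  · exact (ae_restrict_iff' measurableSet_Ioi).2
      (Filter.Eventually.of_forall fun x hx y _ => hle x hx bp' bq' y)
  · refine Filter.Eventually.of_forall fun x y _ => ?_
    exact (((dp _).comp_add_const y (c * x)).sub
      (((dq _).comp_add_const y (c * x)).const_mul (b * x))).const_mul (w x)

lemma enorm_profileConv_le (hA : 0 ≤ A) (bw : ∀ x : ℝ, 0 < x → ‖w x‖ ≤ A * Real.exp (-x))
    (cp : Continuous p) (cq : Continuous q) (z : ℝ) :
    ‖profileConv w b c p q z‖ₑ ≤ ENNReal.ofReal (2 * A * (1 + ‖b‖)) *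
      ∫⁻ x, (‖p (z + c * x)‖ₑ + ‖q (z + c * x)‖ₑ) ∂expMeasure := by
  rw [expMeasure, lintegral_withDensity_eq_lintegral_mul _ (by fun_prop) (by fun_prop),
    ← lintegral_const_mul _ (by fun_prop)]
  refine (enorm_integral_le_lintegral_enorm _).trans
    (setLIntegral_mono (by fun_prop) fun x hx => ?_)
  rw [← ofReal_norm]
  refine (ENNReal.ofReal_le_ofReal (norm_profile_integrand_le bw hx _ _)).trans_eq ?_
  rw [ENNReal.ofReal_mul (by positivity), ENNReal.ofReal_mul (by positivity),
    ENNReal.ofReal_add (by positivity) (by positivity), ofReal_norm, ofReal_norm, Pi.mul_apply,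
    mul_assoc]

lemma continuous_profileConv (hA : 0 ≤ A) (cw : ContinuousOn w (Ioi 0))
    (bw : ∀ x : ℝ, 0 < x → ‖w x‖ ≤ A * Real.exp (-x)) (cp : Continuous p) (cq : Continuous q)
    (bp : ∀ z, ‖p z‖ ≤ M) (bq : ∀ z, ‖q z‖ ≤ M) : Continuous (profileConv w b c p q) := by
  have hi : IntegrableOn (fun x : ℝ => 2 * A * (1 + ‖b‖) * Real.exp (-(1 / 2) * x) * (M + M))
      (Ioi 0) := ((exp_neg_integrableOn_Ioi 0 (by norm_num)).const_mul _).mul_const _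
  refine continuous_of_dominated (fun y => profile_integrand_aestronglyMeasurable cw cp cq y)
    (fun y => (ae_restrict_iff' measurableSet_Ioi).2 (Filter.Eventually.of_forall fun x hx => ?_))
    hi (Filter.Eventually.of_forall fun x => by fun_prop)
  refine (norm_profile_integrand_le bw hx _ _).trans ?_
  gcongr <;> [exact bp _; exact bq _]

lemma norm_profileConv_le (hA : 0 ≤ A) (hM : 0 ≤ M)
    (bw : ∀ x : ℝ, 0 < x → ‖w x‖ ≤ A * Real.exp (-x)) (cp : Continuous p) (cq : Continuous q)
    (bp : ∀ z, ‖p z‖ ≤ M) (bq : ∀ z, ‖q z‖ ≤ M) (z : ℝ) :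
    ‖profileConv w b c p q z‖ ≤ 8 * A * (1 + ‖b‖) * M := by
  have h := enorm_profileConv_le (b := b) (c := c) hA bw cp cq z
  have h2 : ∫⁻ x, (‖p (z + c * x)‖ₑ + ‖q (z + c * x)‖ₑ) ∂expMeasure ≤
      ENNReal.ofReal (4 * M) := by
    calc ∫⁻ x, (‖p (z + c * x)‖ₑ + ‖q (z + c * x)‖ₑ) ∂expMeasure
        ≤ ∫⁻ _, ENNReal.ofReal (M + M) ∂expMeasure := by
          refine lintegral_mono fun x => ?_
          rw [← ofReal_norm, ← ofReal_norm, ← ENNReal.ofReal_add (norm_nonneg _) (norm_nonneg _)]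
          exact ENNReal.ofReal_le_ofReal (add_le_add (bp _) (bq _))
      _ = ENNReal.ofReal (4 * M) := by
          rw [lintegral_const, expMeasure_univ, ← ENNReal.ofReal_ofNat 2,
            ← ENNReal.ofReal_mul (by positivity)]
          congr 1
          ring
  have h3 := h.trans (mul_le_mul_right h2 _)
  rw [← ENNReal.ofReal_mul (by positivity), ← ofReal_norm,
    ENNReal.ofReal_le_ofReal_iff (by positivity)] at h3
  linarith

end profileConv

def dataMajorant (ρ ω : ℝ → ℂ) (z : ℝ) : ℝ≥0∞ :=
  2 * ∑ k ∈ Finset.range 5, (‖iteratedDeriv k ρ z‖ₑ + ‖iteratedDeriv k ω z‖ₑ)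

lemma hasDerivAt_iteratedDeriv {f : ℝ → ℂ} (hf : ContDiff ℝ (⊤ : ℕ∞) f) (k : ℕ) (z : ℝ) :
    HasDerivAt (iteratedDeriv k f) (iteratedDeriv (k + 1) f z) z := by
  rw [iteratedDeriv_succ]
  exact ((hf.differentiable_iteratedDeriv k (by exact_mod_cast WithTop.coe_lt_top k)) z).hasDerivAt

lemma continuous_iteratedDeriv_of_smooth {f : ℝ → ℂ} (hf : ContDiff ℝ (⊤ : ℕ∞) f) (k : ℕ) :
    Continuous (iteratedDeriv k f) :=
  continuous_iff_continuousAt.2 fun x => (hasDerivAt_iteratedDeriv hf k x).continuousAt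

lemma exists_bound_iteratedDeriv {f : ℝ → ℂ} (hf : ContDiff ℝ (⊤ : ℕ∞) f)
    (hs : HasCompactSupport f) (k : ℕ) : ∃ M, ∀ z, ‖iteratedDeriv k f z‖ ≤ M := by
  have h : HasCompactSupport (iteratedDeriv k f) := by
    induction k with
    | zero => simpa using hs
    | succ k ih =>
      rw [iteratedDeriv_succ]
      exact ih.deriv
  exact h.exists_bound_of_continuous (continuous_iteratedDeriv_of_smooth hf k)

lemma measurable_dataMajorant {ρ ω : ℝ → ℂ} (hρ : ContDiff ℝ (⊤ : ℕ∞) ρ)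
    (hω : ContDiff ℝ (⊤ : ℕ∞) ω) : Measurable (dataMajorant ρ ω) := by
  have h1 := fun k => (continuous_iteratedDeriv_of_smooth hρ k).measurable
  have h2 := fun k => (continuous_iteratedDeriv_of_smooth hω k).measurable
  unfold dataMajorant
  fun_prop

lemma eLpNorm_dataMajorant_le {ρ ω : ℝ → ℂ} (hρ : ContDiff ℝ (⊤ : ℕ∞) ρ)
    (hω : ContDiff ℝ (⊤ : ℕ∞) ω) : eLpNorm (dataMajorant ρ ω) 2 volume ≤ 2 * Qsum 5 ρ ω := by
  have h1 := fun k => (continuous_iteratedDeriv_of_smooth hρ k).measurable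
  have h2 := fun k => (continuous_iteratedDeriv_of_smooth hω k).measurable
  have h : eLpNorm (fun z => ∑ k ∈ Finset.range 5,
      (‖iteratedDeriv k ρ z‖ₑ + ‖iteratedDeriv k ω z‖ₑ)) 2 volume ≤ Qsum 5 ρ ω := by
    have e : (fun z => ∑ k ∈ Finset.range 5, (‖iteratedDeriv k ρ z‖ₑ + ‖iteratedDeriv k ω z‖ₑ)) =
        ∑ k ∈ Finset.range 5, fun z => (‖iteratedDeriv k ρ z‖ₑ + ‖iteratedDeriv k ω z‖ₑ) := by
      ext z
      rw [Finset.sum_apply]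
    rw [e]
    refine (eLpNorm_sum_le (fun k _ => by fun_prop) one_le_two).trans
      (Finset.sum_le_sum fun k _ => ?_)
    refine (eLpNorm_add_le (f := fun z => ‖iteratedDeriv k ρ z‖ₑ)
      (g := fun z => ‖iteratedDeriv k ω z‖ₑ) (by fun_prop) (by fun_prop) one_le_two).trans_eq ?_
    simp only [eLpNorm_enorm]
  have h' : dataMajorant ρ ω = (fun z => ∑ k ∈ Finset.range 5,
      (‖iteratedDeriv k ρ z‖ₑ + ‖iteratedDeriv k ω z‖ₑ)) + fun z => ∑ k ∈ Finset.range 5,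
      (‖iteratedDeriv k ρ z‖ₑ + ‖iteratedDeriv k ω z‖ₑ) := by
    ext z
    rw [dataMajorant, two_mul, Pi.add_apply]
  rw [h', two_mul]
  exact (eLpNorm_add_le (by fun_prop) (by fun_prop) one_le_two).trans (add_le_add h h)

lemma sum_shifted_enorm_le (ρ ω : ℝ → ℂ) {m : ℕ} (hm : 1 ≤ m) (z : ℝ) :
    ∑ j ∈ Finset.range 3,
      (‖iteratedDeriv (j + 2) ρ z - (m : ℂ) ^ 2 * iteratedDeriv j ρ z‖ₑ +
        ‖iteratedDeriv (j + 2) ω z - (m : ℂ) ^ 2 * iteratedDeriv j ω z‖ₑ) ≤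
      (m : ℝ≥0∞) ^ 2 * dataMajorant ρ ω z := by
  have hm1 : (1 : ℝ≥0∞) ≤ (m : ℝ≥0∞) ^ 2 := one_le_pow₀ (by exact_mod_cast hm)
  have hmn : ‖(m : ℂ) ^ 2‖ₑ = (m : ℝ≥0∞) ^ 2 := by
    rw [enorm_pow, ← ofReal_norm, Complex.norm_natCast, ENNReal.ofReal_natCast]
  have h : ∀ u v : ℂ, ‖u - (m : ℂ) ^ 2 * v‖ₑ ≤ (m : ℝ≥0∞) ^ 2 * (‖u‖ₑ + ‖v‖ₑ) := fun u v => by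
    refine (enorm_sub_le).trans ?_
    rw [enorm_mul, hmn, mul_add]
    gcongr
    exact le_mul_of_one_le_left' hm1
  calc _ ≤ ∑ j ∈ Finset.range 3, ((m : ℝ≥0∞) ^ 2 * (‖iteratedDeriv (j + 2) ρ z‖ₑ +
        ‖iteratedDeriv j ρ z‖ₑ) + (m : ℝ≥0∞) ^ 2 * (‖iteratedDeriv (j + 2) ω z‖ₑ +
        ‖iteratedDeriv j ω z‖ₑ)) := Finset.sum_le_sum fun j _ => add_le_add (h _ _) (h _ _)
    _ = (m : ℝ≥0∞) ^ 2 * ∑ j ∈ Finset.range 3, ((‖iteratedDeriv (j + 2) ρ z‖ₑ +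
        ‖iteratedDeriv (j + 2) ω z‖ₑ) + (‖iteratedDeriv j ρ z‖ₑ + ‖iteratedDeriv j ω z‖ₑ)) := by
      rw [Finset.mul_sum]
      exact Finset.sum_congr rfl fun j _ => by ring
    _ ≤ (m : ℝ≥0∞) ^ 2 * dataMajorant ρ ω z := by
      gcongr
      rw [dataMajorant, two_mul, Finset.sum_add_distrib]
      set g : ℕ → ℝ≥0∞ := fun k => ‖iteratedDeriv k ρ z‖ₑ + ‖iteratedDeriv k ω z‖ₑ
      refine add_le_add (?_ : ∑ j ∈ Finset.range 3, g (j + 2) ≤ ∑ k ∈ Finset.range 5, g k)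
        (Finset.sum_le_sum_of_subset (Finset.range_mono (by norm_num)))
      rw [Finset.sum_range_succ' g, Finset.sum_range_succ' (fun k => g (k + 1))]
      exact le_self_add.trans le_self_add

def smearedMajorant (κ t c c' : ℝ) (ρ ω : ℝ → ℂ) (y : ℝ) : ℝ≥0∞ :=
  ∫⁻ s, ∫⁻ x, dataMajorant ρ ω (y + c' * s + c * x) ∂expMeasure ∂oscMeasure κ t

lemma measurable_lintegral_translate (ν : Measure ℝ) [SFinite ν] {F : ℝ → ℝ≥0∞}
    (hF : Measurable F) (c : ℝ) : Measurable fun y => ∫⁻ s, F (y + c * s) ∂ν := by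
  have hm : Measurable (Function.uncurry fun (y s : ℝ) => F (y + c * s)) := by
    unfold Function.uncurry
    fun_prop
  exact hm.lintegral_prod_right'

lemma measurable_smearedMajorant {κ t c c' : ℝ} {ρ ω : ℝ → ℂ} (hρ : ContDiff ℝ (⊤ : ℕ∞) ρ)
    (hω : ContDiff ℝ (⊤ : ℕ∞) ω) : Measurable (smearedMajorant κ t c c' ρ ω) :=
  measurable_lintegral_translate _
    (measurable_lintegral_translate expMeasure (measurable_dataMajorant hρ hω) c) c'

lemma eLpNorm_smearedMajorant_le {κ t c c' : ℝ} (hκ0 : 0 < κ) (hκ1 : κ < 1) (ht : 0 < t)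
    {ρ ω : ℝ → ℂ} (hρ : ContDiff ℝ (⊤ : ℕ∞) ρ) (hω : ContDiff ℝ (⊤ : ℕ∞) ω) :
    eLpNorm (smearedMajorant κ t c c' ρ ω) 2 volume ≤
      ENNReal.ofReal ((1 / κ + 1 + 1 / (1 - κ)) * t ^ (-1 - κ)) * (2 * (2 * Qsum 5 ρ ω)) := by
  have hm := measurable_dataMajorant hρ hω
  have h1 := eLpNorm_lintegral_translate_le expMeasure hm c
  have h2 := eLpNorm_lintegral_translate_le (oscMeasure κ t)
    (measurable_lintegral_translate expMeasure hm c) c'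
  rw [oscMeasure_univ hκ0 hκ1 ht] at h2
  rw [expMeasure_univ] at h1
  refine h2.trans (mul_le_mul_right (h1.trans (mul_le_mul_right ?_ _)) _)
  exact eLpNorm_dataMajorant_le hρ hω

lemma inner_integral_eq_profileConv (β : ℝ) {m : ℕ} (hm : 1 ≤ m) (w ρ ω : ℝ → ℂ) (σ η y : ℝ) :
    ∫ ξ in Ioi (0 : ℝ), w (m * ξ) * Gm β m ρ ω (σ * η) (σ * ξ) y =
      (m : ℂ)⁻¹ * profileConv w ((1 / (β : ℂ) ^ 2) * (σ / m : ℝ)) (σ / m)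
        (fun z => iteratedDeriv 2 ρ z - (m : ℂ) ^ 2 * iteratedDeriv 0 ρ z)
        (fun z => iteratedDeriv 2 ω z - (m : ℂ) ^ 2 * iteratedDeriv 0 ω z) (y - σ * η) := by
  have hm0 : (0 : ℝ) < m := by exact_mod_cast hm
  have h := integral_comp_mul_left_Ioi (fun x => w x * Gm β m ρ ω (σ * η) (σ / m * x) y) 0 hm0
  rw [mul_zero] at h
  have e : ∀ ξ : ℝ, σ / m * (m * ξ) = σ * ξ := fun ξ => by field_simp
  simp only [e] at h
  rw [h, profileConv, Complex.real_smul]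
  congr 1
  · push_cast; rfl
  · refine setIntegral_congr_fun measurableSet_Ioi fun x _ => ?_
    simp only [Gm, iteratedDeriv_zero, iteratedDeriv_succ]
    rw [show σ / m * x + y - σ * η = y - σ * η + σ / m * x by ring]
    push_cast
    ring

lemma enorm_oscillatory_half_le {β : ℝ} {w w₁ w₂ : ℝ → ℂ} {κ A : ℝ} (hκ0 : 0 < κ)
    (hκ1 : κ < 1) (hA : 0 < A) (cw₂ : ContinuousOn w₂ (Ioi 0))
    (dw : ∀ x, 0 < x → HasDerivAt w (w₁ x) x) (dw₁ : ∀ x, 0 < x → HasDerivAt w₁ (w₂ x) x)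
    (bw : ∀ x : ℝ, 0 < x → ‖w x‖ ≤ A * Real.exp (-x) ∧ ‖w x‖ ≤ A * x ^ κ ∧
      ‖w x‖ ≤ A * x ^ (κ - 1) ∧ ‖w₁ x‖ ≤ A * x ^ (κ - 1) ∧ ‖w x‖ ≤ A * x ^ (κ - 2) ∧
      ‖w₁ x‖ ≤ A * x ^ (κ - 2) ∧ ‖w₂ x‖ ≤ A * x ^ (κ - 2))
    {ρ ω : ℝ → ℂ} (hρ : ContDiff ℝ (⊤ : ℕ∞) ρ) (hω : ContDiff ℝ (⊤ : ℕ∞) ω)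
    (sρ : HasCompactSupport ρ) (sω : HasCompactSupport ω) {m : ℕ} (hm : 1 ≤ m) {σ t : ℝ}
    (hσ : |σ| = 1) (ht : 0 < t) (y : ℝ) :
    ‖∫ η in Ioi (0 : ℝ), Complex.exp (I * m * (σ * η : ℝ) * t) * w (m * η) *
      ∫ ξ in Ioi (0 : ℝ), w (m * ξ) * Gm β m ρ ω (σ * η) (σ * ξ) y‖ₑ ≤
      ENNReal.ofReal (4 * A ^ 2 * (1 + 1 / β ^ 2)) *
        smearedMajorant κ t (σ / m) (-(σ / m)) ρ ω y := by
  have hm1 : (1 : ℝ) ≤ m := by exact_mod_cast hm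
  have hm0 : (0 : ℝ) < m := by linarith
  have hmc : (m : ℂ) ≠ 0 := by exact_mod_cast hm0.ne'
  set c : ℝ := σ / m with hc
  have hcabs : |c| ≤ 1 := by
    rw [hc, abs_div, hσ, abs_of_pos hm0]
    exact (div_le_one hm0).2 hm1
  set b : ℂ := (1 / (β : ℂ) ^ 2) * (c : ℝ) with hb
  have hbn : ‖b‖ ≤ 1 / β ^ 2 := by
    rw [hb, norm_mul, norm_div, norm_one, norm_pow, Complex.norm_real, Complex.norm_real,
      Real.norm_eq_abs, Real.norm_eq_abs, sq_abs]
    exact mul_le_of_le_one_right (by positivity) hcabs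
  set p : ℕ → ℝ → ℂ := fun j z =>
    iteratedDeriv (j + 2) ρ z - (m : ℂ) ^ 2 * iteratedDeriv j ρ z with hp
  set q : ℕ → ℝ → ℂ := fun j z =>
    iteratedDeriv (j + 2) ω z - (m : ℂ) ^ 2 * iteratedDeriv j ω z with hq
  have hder : ∀ {f : ℝ → ℂ}, ContDiff ℝ (⊤ : ℕ∞) f → ∀ (j : ℕ) (z : ℝ),
      HasDerivAt (fun z => iteratedDeriv (j + 2) f z - (m : ℂ) ^ 2 * iteratedDeriv j f z)
        (iteratedDeriv (j + 1 + 2) f z - (m : ℂ) ^ 2 * iteratedDeriv (j + 1) f z) z :=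
    fun hf j z => (hasDerivAt_iteratedDeriv hf (j + 2) z).sub
      ((hasDerivAt_iteratedDeriv hf j z).const_mul _)
  have dp : ∀ j z, HasDerivAt (p j) (p (j + 1) z) z := hder hρ
  have dq : ∀ j z, HasDerivAt (q j) (q (j + 1) z) z := hder hω
  have cp : ∀ j, Continuous (p j) := fun j =>
    continuous_iff_continuousAt.2 fun z => (dp j z).continuousAt
  have cq : ∀ j, Continuous (q j) := fun j =>
    continuous_iff_continuousAt.2 fun z => (dq j z).continuousAt
  have hbd : ∀ {f : ℝ → ℂ}, ContDiff ℝ (⊤ : ℕ∞) f → HasCompactSupport f → ∀ j : ℕ, ∃ M, ∀ z,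
      ‖iteratedDeriv (j + 2) f z - (m : ℂ) ^ 2 * iteratedDeriv j f z‖ ≤ M := fun hf sf j => by
    obtain ⟨M₁, h1⟩ := exists_bound_iteratedDeriv hf sf (j + 2)
    obtain ⟨M₂, h2⟩ := exists_bound_iteratedDeriv hf sf j
    refine ⟨M₁ + ‖(m : ℂ) ^ 2‖ * M₂, fun z => (norm_sub_le _ _).trans (add_le_add (h1 z) ?_)⟩
    rw [norm_mul]
    gcongr
    exact h2 z
  choose Mp hMp using hbd hρ sρ
  choose Mq hMq using hbd hω sω
  set M : ℝ := ∑ j ∈ Finset.range 3, (|Mp j| + |Mq j|) with hM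
  have hM0 : 0 ≤ M := by positivity
  have hMj : ∀ j ∈ Finset.range 3, |Mp j| + |Mq j| ≤ M := fun j hj =>
    Finset.single_le_sum (f := fun j => |Mp j| + |Mq j|) (fun i _ => by positivity) hj
  have bp : ∀ j ∈ Finset.range 3, ∀ z, ‖p j z‖ ≤ M := fun j hj z => by
    linarith [hMp j z, le_abs_self (Mp j), abs_nonneg (Mq j), hMj j hj]
  have bq : ∀ j ∈ Finset.range 3, ∀ z, ‖q j z‖ ≤ M := fun j hj z => by
    linarith [hMq j z, le_abs_self (Mq j), abs_nonneg (Mp j), hMj j hj]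
  have cw : ContinuousOn w (Ioi 0) := fun x hx => (dw x hx).continuousAt.continuousWithinAt
  have bw0 : ∀ x : ℝ, 0 < x → ‖w x‖ ≤ A * Real.exp (-x) := fun x hx => (bw x hx).1
  set H : ℕ → ℝ → ℂ := fun j => profileConv w b c (p j) (q j) with hH
  have m0 : 0 ∈ Finset.range 3 := by simp
  have m1 : 1 ∈ Finset.range 3 := by simp
  have m2 : 2 ∈ Finset.range 3 := by simp
  have dH : ∀ j ∈ Finset.range 3, j + 1 ∈ Finset.range 3 → ∀ z,
      HasDerivAt (H j) (H (j + 1) z) z := fun j hj hj' z =>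
    hasDerivAt_profileConv cw bw0 (dp j) (dq j) (cp _) (cq _) (bp j hj) (bq j hj) (bp _ hj')
      (bq _ hj') z
  have cH : Continuous (H 2) :=
    continuous_profileConv hA.le cw bw0 (cp 2) (cq 2) (bp 2 m2) (bq 2 m2)
  set K : ℝ := 8 * A * (1 + ‖b‖) * M
  have bH : ∀ j ∈ Finset.range 3, ∀ z, ‖H j z‖ ≤ K := fun j hj z =>
    norm_profileConv_le hA.le hM0 bw0 (cp j) (cq j) (bp j hj) (bq j hj) z
  have hτ : σ * t ≠ 0 := mul_ne_zero (by rintro rfl; simp at hσ) ht.ne'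
  have hchain : ∀ {f f' : ℝ → ℂ}, (∀ z, HasDerivAt f (f' z) z) → ∀ s : ℝ,
      HasDerivAt (fun s => f (y + -c * s)) ((-c : ℝ) * f' (y + -c * s)) s := fun hf s => by
    have h1 : HasDerivAt (fun s : ℝ => y + -c * s) (-c * 1) s :=
      ((hasDerivAt_id s).const_mul (-c)).const_add y
    rw [mul_one] at h1
    exact (hf _).scomp s h1
  have hcn : ∀ z : ℂ, ‖((-c : ℝ) : ℂ) * z‖ ≤ ‖z‖ := fun z => by
    rw [norm_mul, Complex.norm_real, norm_neg]
    exact mul_le_of_le_one_left (norm_nonneg z) hcabs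
  have hcont : Continuous fun s : ℝ => y + -c * s := by fun_prop
  have key := enorm_integral_exp_mul_mul_le (h := fun s => H 0 (y + -c * s))
    (h₁ := fun s => (-c : ℝ) * H 1 (y + -c * s))
    (h₂ := fun s => (-c : ℝ) * ((-c : ℝ) * H 2 (y + -c * s))) (K := K) hκ0 hκ1 hτ hA cw₂ dw dw₁ bw
    (hchain (dH 0 m0 m1)) (fun s => (hchain (dH 1 m1 m2) s).const_mul _)
    (continuous_const.mul (continuous_const.mul (cH.comp hcont)))
    (fun s => ⟨bH 0 m0 _, (hcn _).trans (bH 1 m1 _), (hcn _).trans ((hcn _).trans (bH 2 m2 _))⟩)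
  rw [abs_mul, hσ, one_mul, abs_of_pos ht] at key
  have hcv : ∫ η in Ioi (0 : ℝ), Complex.exp (I * m * (σ * η : ℝ) * t) * w (m * η) *
      ∫ ξ in Ioi (0 : ℝ), w (m * ξ) * Gm β m ρ ω (σ * η) (σ * ξ) y =
      ((m : ℂ) ^ 2)⁻¹ * ∫ s in Ioi (0 : ℝ), Complex.exp (I * (σ * t : ℝ) * s) *
        (w s * H 0 (y + -c * s)) := by
    have h := integral_comp_mul_left_Ioi (fun s : ℝ => (m : ℂ)⁻¹ *
      (Complex.exp (I * (σ * t : ℝ) * s) * (w s * H 0 (y + -c * s)))) 0 hm0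
    rw [mul_zero, Complex.real_smul] at h
    have h' : ((m : ℂ) ^ 2)⁻¹ * ∫ s in Ioi (0 : ℝ), Complex.exp (I * (σ * t : ℝ) * s) *
        (w s * H 0 (y + -c * s)) = ((m : ℝ)⁻¹ : ℝ) * ((m : ℂ)⁻¹ *
          ∫ s in Ioi (0 : ℝ), Complex.exp (I * (σ * t : ℝ) * s) * (w s * H 0 (y + -c * s))) := by
      push_cast
      ring
    rw [h', ← integral_const_mul, ← h]
    refine setIntegral_congr_fun measurableSet_Ioi fun η _ => ?_
    simp only [inner_integral_eq_profileConv β hm w ρ ω σ η y]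
    have e : y + -c * (m * η) = y - σ * η := by
      rw [hc]; field_simp; ring
    rw [e]
    have e2 : I * m * ((σ * η : ℝ) : ℂ) * t = I * ((σ * t : ℝ) : ℂ) * ((m * η : ℝ) : ℂ) := by
      push_cast; ring
    rw [e2]
    simp only [hH, hp, hq, hb]
    ring
  have hmn : ‖((m : ℂ) ^ 2)⁻¹‖ₑ = ((m : ℝ≥0∞) ^ 2)⁻¹ := by
    rw [enorm_inv (pow_ne_zero 2 hmc), enorm_pow, ← ofReal_norm, Complex.norm_natCast,
      ENNReal.ofReal_natCast]
  have hcne : ∀ z : ℂ, ‖((-c : ℝ) : ℂ) * z‖ₑ ≤ ‖z‖ₑ := fun z => by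
    rw [← ofReal_norm, ← ofReal_norm]
    exact ENNReal.ofReal_le_ofReal (hcn z)
  have hHj : ∀ j z, ‖H j z‖ₑ ≤ ENNReal.ofReal (2 * A * (1 + 1 / β ^ 2)) *
      ∫⁻ x, (‖p j (z + c * x)‖ₑ + ‖q j (z + c * x)‖ₑ) ∂expMeasure := fun j z => by
    refine (enorm_profileConv_le hA.le bw0 (cp j) (cq j) z).trans ?_
    gcongr
  have hsum : ∀ z, ‖H 0 z‖ₑ + ‖H 1 z‖ₑ + ‖H 2 z‖ₑ ≤ (m : ℝ≥0∞) ^ 2 *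
      (ENNReal.ofReal (2 * A * (1 + 1 / β ^ 2)) *
        ∫⁻ x, dataMajorant ρ ω (z + c * x) ∂expMeasure) := fun z => by
    have hmaj := measurable_dataMajorant hρ hω
    calc ‖H 0 z‖ₑ + ‖H 1 z‖ₑ + ‖H 2 z‖ₑ = ∑ j ∈ Finset.range 3, ‖H j z‖ₑ := by
          simp [Finset.sum_range_succ]
      _ ≤ ∑ j ∈ Finset.range 3, ENNReal.ofReal (2 * A * (1 + 1 / β ^ 2)) *
          ∫⁻ x, (‖p j (z + c * x)‖ₑ + ‖q j (z + c * x)‖ₑ) ∂expMeasure :=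
          Finset.sum_le_sum fun j _ => hHj j z
      _ = ENNReal.ofReal (2 * A * (1 + 1 / β ^ 2)) * ∫⁻ x, ∑ j ∈ Finset.range 3,
          (‖p j (z + c * x)‖ₑ + ‖q j (z + c * x)‖ₑ) ∂expMeasure := by
          rw [← Finset.mul_sum, lintegral_finsetSum _ fun j _ => ?_]
          have := (cp j).measurable
          have := (cq j).measurable
          fun_prop
      _ ≤ ENNReal.ofReal (2 * A * (1 + 1 / β ^ 2)) *
          ∫⁻ x, (m : ℝ≥0∞) ^ 2 * dataMajorant ρ ω (z + c * x) ∂expMeasure := by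
          gcongr with x
          exact sum_shifted_enorm_le ρ ω hm (z + c * x)
      _ = _ := by
          rw [lintegral_const_mul _ (by fun_prop)]
          ring
  have hmE : (m : ℝ≥0∞) ^ 2 ≠ 0 := by
    have : m ≠ 0 := by omega
    simpa using this
  have hmT : (m : ℝ≥0∞) ^ 2 ≠ ⊤ := by simp
  rw [hcv, enorm_mul, hmn]
  refine (mul_le_mul_right key _).trans ?_
  calc ((m : ℝ≥0∞) ^ 2)⁻¹ * (ENNReal.ofReal (2 * A) * ∫⁻ s, (‖H 0 (y + -c * s)‖ₑ +
        ‖((-c : ℝ) : ℂ) * H 1 (y + -c * s)‖ₑ +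
        ‖((-c : ℝ) : ℂ) * (((-c : ℝ) : ℂ) * H 2 (y + -c * s))‖ₑ) ∂oscMeasure κ t)
      ≤ ((m : ℝ≥0∞) ^ 2)⁻¹ * (ENNReal.ofReal (2 * A) * ∫⁻ s, ((m : ℝ≥0∞) ^ 2 *
        ENNReal.ofReal (2 * A * (1 + 1 / β ^ 2))) *
        (∫⁻ x, dataMajorant ρ ω (y + -c * s + c * x) ∂expMeasure) ∂oscMeasure κ t) := by
        gcongr with s
        rw [mul_assoc]
        refine le_trans ?_ (hsum (y + -c * s))
        gcongr
        · exact hcne _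
        · exact (hcne _).trans (hcne _)
    _ = (((m : ℝ≥0∞) ^ 2)⁻¹ * (m : ℝ≥0∞) ^ 2) * (ENNReal.ofReal (2 * A) *
        ENNReal.ofReal (2 * A * (1 + 1 / β ^ 2))) * smearedMajorant κ t c (-c) ρ ω y := by
        rw [smearedMajorant, lintegral_const_mul]
        · ring
        · exact (measurable_lintegral_translate expMeasure (measurable_dataMajorant hρ hω) c).comp
            hcont.measurable
    _ = _ := by
        rw [ENNReal.inv_mul_cancel hmE hmT, one_mul, ← ENNReal.ofReal_mul (by positivity)]
        congr 2
        ring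

lemma eLpNorm_two_const_mul_le (D : ℝ≥0∞) {f : ℝ → ℝ≥0∞} (hf : Measurable f) :
    eLpNorm (fun y => D * f y) 2 volume ≤ D * eLpNorm f 2 volume := by
  refine (ENNReal.pow_le_pow_left_iff two_ne_zero).1 ?_
  rw [mul_pow, eLpNorm_two_sq, eLpNorm_two_sq, ← lintegral_const_mul _ (hf.pow_const 2)]
  simp only [mul_pow]
  exact le_rfl

lemma exists_eLpNorm_psiM_le {β : ℝ} (hβ : 0 < β) (hβ4 : β ^ 2 ≠ 1 / 4) :
    ∃ C : ℝ, 0 < C ∧ ∀ (m : ℕ), 1 ≤ m → ∀ ρ ω : ℝ → ℂ, ContDiff ℝ (⊤ : ℕ∞) ρ →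
      HasCompactSupport ρ → ContDiff ℝ (⊤ : ℕ∞) ω → HasCompactSupport ω → ∀ t : ℝ, 0 < t →
      (m : ℝ≥0∞) * eLpNorm (fun y => psiM β m ρ ω t y) 2 volume ≤
        ENNReal.ofReal (C * t ^ (-(3 : ℝ) / 2 + (gam β).re)) * Qsum 5 ρ ω := by
  obtain ⟨w₁, w₂, A, hA, cw₂, dw, dw₁, bw⟩ := whittW_bounds hβ hβ4
  have hμ0 := gam_re_nonneg β
  have hμ1 := gam_re_lt hβ
  set κ : ℝ := 1 / 2 - (gam β).re with hκ
  have hκ0 : 0 < κ := by linarith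
  have hκ1 : κ < 1 := by linarith
  have hκ2 : 0 < 1 - κ := by linarith
  set w : ℝ → ℂ := fun x => whittW (gam β) (2 * (x : ℂ)) with hw
  set c₀ : ℝ := ‖Complex.cos (gam β * (π : ℂ))‖ / (2 * π) with hc₀
  have hc0 : 0 ≤ c₀ := by positivity
  set K : ℝ := 4 * A ^ 2 * (1 + 1 / β ^ 2) with hK
  have hK0 : 0 < K := by positivity
  set L : ℝ := 1 / κ + 1 + 1 / (1 - κ) with hL
  have hL0 : 0 < L := by positivity
  refine ⟨8 * (c₀ + 1) * K * L, by positivity, fun m hm ρ ω hρ sρ hω sω t ht => ?_⟩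
  have hm0 : (m : ℂ) ≠ 0 := by
    have : m ≠ 0 := by omega
    exact_mod_cast this
  have hmE : (m : ℝ≥0∞) ≠ 0 := by
    have : m ≠ 0 := by omega
    exact_mod_cast this
  set B : ℝ → ℝ → ℝ≥0∞ := fun σ => smearedMajorant κ t (σ / m) (-(σ / m)) ρ ω with hB
  have hBm : ∀ σ, Measurable (B σ) := fun σ => measurable_smearedMajorant hρ hω
  have hBn : ∀ σ, eLpNorm (B σ) 2 volume ≤
      ENNReal.ofReal (L * t ^ (-1 - κ)) * (2 * (2 * Qsum 5 ρ ω)) := fun σ =>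
    eLpNorm_smearedMajorant_le hκ0 hκ1 ht hρ hω
  have half := fun (σ : ℝ) (hσ : |σ| = 1) (y : ℝ) =>
    enorm_oscillatory_half_le (β := β) hκ0 hκ1 hA cw₂ dw dw₁ bw hρ hω sρ sω hm hσ ht y
  have hpt : ∀ y, ‖psiM β m ρ ω t y‖ₑ ≤
      ENNReal.ofReal c₀ * (m : ℝ≥0∞)⁻¹ * ENNReal.ofReal K * (B 1 y + B (-1) y) := by
    intro y
    have hp := half 1 (by simp) y
    have hn := half (-1) (by simp) y
    have ew : ∀ η : ℝ, w (m * η) = whittW (gam β) (2 * (m : ℂ) * (η : ℂ)) := fun η => by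
      simp only [hw]
      push_cast
      rw [mul_assoc]
    simp only [one_mul] at hp
    simp only [neg_one_mul] at hn
    have en : ∀ η : ℝ, I * (m : ℂ) * ((-η : ℝ) : ℂ) * t = -(I * m * η * t) := fun η => by
      push_cast; ring
    have hph : ‖Complex.exp (-(Complex.I * m * y * t)) * Complex.cos (gam β * (π : ℂ)) /
        (2 * m * (π : ℂ))‖ₑ = ENNReal.ofReal c₀ * (m : ℝ≥0∞)⁻¹ := by
      have e1 : -(Complex.I * m * y * t) = ((-(m * y * t) : ℝ) : ℂ) * I := by push_cast; ring
      have hmR : (0 : ℝ) < m := by exact_mod_cast hm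
      rw [← ENNReal.ofReal_natCast, ← ENNReal.ofReal_inv_of_pos hmR, ← ENNReal.ofReal_mul hc0,
        ← ofReal_norm, norm_div, norm_mul, e1, Complex.norm_exp_ofReal_mul_I, norm_mul, norm_mul,
        Complex.norm_natCast, Complex.norm_real, Real.norm_of_nonneg Real.pi_pos.le,
        Complex.norm_ofNat]
      congr 1
      rw [hc₀]
      field_simp
    rw [psiM, enorm_mul, hph, mul_assoc (ENNReal.ofReal c₀ * (m : ℝ≥0∞)⁻¹)]
    refine mul_le_mul_right ((enorm_sub_le).trans ?_) _
    rw [mul_add]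
    refine add_le_add ?_ ?_
    · simpa only [ew] using hp
    · simpa only [ew, en] using hn
  have hnorm : eLpNorm (fun y => psiM β m ρ ω t y) 2 volume ≤
      ENNReal.ofReal c₀ * (m : ℝ≥0∞)⁻¹ * ENNReal.ofReal K *
        (2 * (ENNReal.ofReal (L * t ^ (-1 - κ)) * (2 * (2 * Qsum 5 ρ ω)))) := by
    refine (eLpNorm_mono_enorm (g := fun y => ENNReal.ofReal c₀ * (m : ℝ≥0∞)⁻¹ *
      ENNReal.ofReal K * (B 1 y + B (-1) y)) hpt).trans ?_
    refine (eLpNorm_two_const_mul_le _ ((hBm 1).add (hBm (-1)))).trans (mul_le_mul_right ?_ _)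
    rw [two_mul]
    exact (eLpNorm_add_le (hBm 1).aestronglyMeasurable (hBm (-1)).aestronglyMeasurable
      one_le_two).trans (add_le_add (hBn 1) (hBn (-1)))
  calc (m : ℝ≥0∞) * eLpNorm (fun y => psiM β m ρ ω t y) 2 volume
      ≤ (m : ℝ≥0∞) * (ENNReal.ofReal c₀ * (m : ℝ≥0∞)⁻¹ * ENNReal.ofReal K *
        (2 * (ENNReal.ofReal (L * t ^ (-1 - κ)) * (2 * (2 * Qsum 5 ρ ω))))) := by gcongr
    _ = ((m : ℝ≥0∞) * (m : ℝ≥0∞)⁻¹) * (8 * ENNReal.ofReal c₀ * ENNReal.ofReal K *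
        ENNReal.ofReal (L * t ^ (-1 - κ))) * Qsum 5 ρ ω := by ring
    _ ≤ _ := by
      rw [ENNReal.mul_inv_cancel hmE (ENNReal.natCast_ne_top m), one_mul,
        ← ENNReal.ofReal_ofNat 8, ← ENNReal.ofReal_mul (by norm_num),
        ← ENNReal.ofReal_mul (by positivity), ← ENNReal.ofReal_mul (by positivity),
        show -(3 : ℝ) / 2 + (gam β).re = -1 - κ by rw [hκ]; ring, mul_assoc _ L]
      gcongr
      linarith

/-- Fourier-side form of estimate (1.13) of Theorem 1.2, case `β² ≠ 1/4`:
the vertical velocity `u^y = ∂_xψ` (mode `imψ_m`) decays in `L²(𝕋×ℝ)` at rate `t^{−3/2+μ}`: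
`(∑_{m≥1} m² ‖ψ_m(t)‖²_{L²})^{1/2} ≤ C t^{−3/2+μ} (∑_{m≥1} Q_{2,m}²)^{1/2}`. -/
theorem uy_decay_summed (β : ℝ) (hβ : 0 < β) (hβ4 : β ^ 2 ≠ 1 / 4) :
    ∃ C : ℝ, 0 < C ∧
      ∀ (ρ₀ ω₀ : ℕ → ℝ → ℂ),
        (∀ m : ℕ, 1 ≤ m → ContDiff ℝ (⊤ : ℕ∞) (ρ₀ m) ∧ HasCompactSupport (ρ₀ m)
          ∧ ContDiff ℝ (⊤ : ℕ∞) (ω₀ m) ∧ HasCompactSupport (ω₀ m)) →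
      ∀ t : ℝ, 1 ≤ t →
        (∑' m : ℕ, ((m + 1 : ℕ) : ℝ≥0∞) ^ 2 *
            (eLpNorm (fun y => psiM β (m + 1) (ρ₀ (m + 1)) (ω₀ (m + 1)) t y)
              2 (volume : Measure ℝ)) ^ 2) ^ ((1 : ℝ) / 2) ≤
          ENNReal.ofReal (C * t ^ (-(3 : ℝ) / 2 + (gam β).re)) *
            (∑' m : ℕ, (Qsum 5 (ρ₀ (m + 1)) (ω₀ (m + 1))) ^ 2) ^ ((1 : ℝ) / 2) := by
  obtain ⟨C, hC, h⟩ := exists_eLpNorm_psiM_le hβ hβ4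
  refine ⟨C, hC, fun ρ₀ ω₀ hdata t ht => ?_⟩
  set E : ℝ≥0∞ := ENNReal.ofReal (C * t ^ (-(3 : ℝ) / 2 + (gam β).re))
  have hsum : ∑' m : ℕ, ((m + 1 : ℕ) : ℝ≥0∞) ^ 2 *
      (eLpNorm (fun y => psiM β (m + 1) (ρ₀ (m + 1)) (ω₀ (m + 1)) t y) 2 volume) ^ 2 ≤
      E ^ 2 * ∑' m : ℕ, (Qsum 5 (ρ₀ (m + 1)) (ω₀ (m + 1))) ^ 2 := by
    rw [← ENNReal.tsum_mul_left]
    refine ENNReal.tsum_le_tsum fun m => ?_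
    obtain ⟨h1, h2, h3, h4⟩ := hdata (m + 1) (by omega)
    rw [← mul_pow, ← mul_pow]
    exact pow_le_pow_left' (h (m + 1) (by omega) _ _ h1 h2 h3 h4 t (by linarith)) 2
  refine (ENNReal.rpow_le_rpow hsum (by norm_num)).trans_eq ?_
  rw [ENNReal.mul_rpow_of_nonneg _ _ (by norm_num), ← ENNReal.rpow_two, ← ENNReal.rpow_mul]
  norm_num
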